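/- arXiv:2003.05607 — 12 statements merged into one kernel-verified Lean document; each statement's English description precedes it below -/
import Mathlib

section
/- Let A be a semiprime idiomatic-quantale. Then ann(a·b) = ann(a ⊓ b) for all a, b ∈ A. -/
/-- The left annihilator `ann a = ⨆ {x | x·a = ⊥}` in a complete lattice equipped
with a multiplication. -/
def qann {A : Type*} [CompleteLattice A] (mul : A → A → A) (a : A) : A :=
  sSup {x | mul x a = ⊥}

/-- Let `A` be a semiprime idiomatic-quantale.
Then `ann (a·b) = ann (a ⊓ b)` for all `a, b ∈ A`. -/
theorem stmt_0 {A : Type*} [CompleteLattice A] (mul : A → A → A)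
    -- quantale axioms
    (hassoc : ∀ a b c : A, mul (mul a b) c = mul a (mul b c))
    (hsupl : ∀ (a : A) (X : Set A), mul a (sSup X) = sSup ((fun x => mul a x) '' X))
    (hsupr : ∀ (a : A) (X : Set A), mul (sSup X) a = sSup ((fun x => mul x a) '' X))
    -- the underlying lattice is modular and upper-continuous (an idiom)
    (hmod : ∀ a b c : A, a ≤ b → (a ⊔ c) ⊓ b = a ⊔ (c ⊓ b))
    (hucont : ∀ (a : A) (X : Set A), DirectedOn (· ≤ ·) X →
      a ⊓ sSup X = sSup ((fun x => a ⊓ x) '' X))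
    -- the product lies below the meet
    (hmulinf : ∀ a b : A, mul a b ≤ a ⊓ b)
    -- `A` is semiprime
    (hsemi : ∀ a : A, mul a a = ⊥ → a = ⊥)
    (a b : A) :
    qann mul (mul a b) = qann mul (a ⊓ b) := by
  have mono_right : ∀ x {y z : A}, y ≤ z → mul x y ≤ mul x z := by
    intro x y z h
    have key := hsupl x {y, z}
    rw [sSup_pair, sup_eq_right.2 h, Set.image_pair, sSup_pair] at key
    exact sup_eq_right.1 key.symm
  have mono_left : ∀ x {y z : A}, y ≤ z → mul y x ≤ mul z x := by
    intro x y z h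
    have key := hsupr x {y, z}
    rw [sSup_pair, sup_eq_right.2 h, Set.image_pair, sSup_pair] at key
    exact sup_eq_right.1 key.symm
  have annihilates_iff : ∀ x, mul x (mul a b) = ⊥ ↔ mul x (a ⊓ b) = ⊥ := by
    intro x
    constructor
    · intro h
      refine hsemi _ (le_bot_iff.1 ?_)
      calc mul (mul x (a ⊓ b)) (mul x (a ⊓ b))
          ≤ mul (mul x (a ⊓ b)) b :=
            mono_right _ (((hmulinf _ _).trans inf_le_right).trans inf_le_right)
        _ ≤ mul (mul x a) b := mono_left _ (mono_right _ inf_le_left)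
        _ = ⊥ := by rw [hassoc, h]
    · intro h
      exact le_bot_iff.1 ((mono_right x (hmulinf a b)).trans h.le)
  simp only [qann, annihilates_iff]
end

section
/- Let A be a quantale with a·b ≤ a ⊓ b for all a, b ∈ A, and let j : A → A be a monotone map such that a ≤ j(a) for all a ∈ A, j(0) = 0, and j(x)·j(y) ≤ j(x·y) for all x, y ∈ A. Then j(ann(a)) = ann(a) for all a ∈ A. -/
/-- A multiplication distributing over suprema on the right argument is monotone in it. -/
theorem mul_le_mul_of_sSup_distrib {A : Type*} [CompleteLattice A] {mul : A → A → A}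
    (hsupl : ∀ (a : A) (X : Set A), mul a (sSup X) = sSup ((fun x => mul a x) '' X))
    (c : A) {x y : A} (hxy : x ≤ y) : mul c x ≤ mul c y := by
  have h := hsupl c {x, y}
  rw [sSup_pair, sup_eq_right.2 hxy] at h
  rw [h]
  exact le_sSup ⟨x, by simp, rfl⟩

/-- The left annihilator of `a` annihilates `a`. -/
theorem qann_mul_eq_bot {A : Type*} [CompleteLattice A] {mul : A → A → A}
    (hsupr : ∀ (a : A) (X : Set A), mul (sSup X) a = sSup ((fun x => mul x a) '' X))
    (a : A) : mul (qann mul a) a = ⊥ := by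
  rw [qann, hsupr, sSup_eq_bot]
  rintro _ ⟨x, hx, rfl⟩
  exact hx

/-- Let `A` be a quantale with `a·b ≤ a ⊓ b`, and let `j : A → A` be monotone,
inflationary, with `j ⊥ = ⊥` and `j x · j y ≤ j (x·y)`.
Then `j (ann a) = ann a` for all `a ∈ A`. -/
theorem stmt_2 {A : Type*} [CompleteLattice A] (mul : A → A → A)
    -- quantale axioms
    (hassoc : ∀ a b c : A, mul (mul a b) c = mul a (mul b c))
    (hsupl : ∀ (a : A) (X : Set A), mul a (sSup X) = sSup ((fun x => mul a x) '' X))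
    (hsupr : ∀ (a : A) (X : Set A), mul (sSup X) a = sSup ((fun x => mul x a) '' X))
    -- the product lies below the meet
    (hmulinf : ∀ a b : A, mul a b ≤ a ⊓ b)
    -- the map `j`
    (j : A → A)
    (hjmono : Monotone j)
    (hjinfl : ∀ a : A, a ≤ j a)
    (hjbot : j ⊥ = ⊥)
    (hjmul : ∀ x y : A, mul (j x) (j y) ≤ j (mul x y))
    (a : A) :
    j (qann mul a) = qann mul a := by
  refine le_antisymm (le_sSup (le_bot_iff.1 ?_)) (hjinfl _)
  calc mul (j (qann mul a)) a ≤ mul (j (qann mul a)) (j a) :=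
        mul_le_mul_of_sSup_distrib hsupl _ (hjinfl a)
    _ ≤ j (mul (qann mul a) a) := hjmul _ _
    _ = ⊥ := by rw [qann_mul_eq_bot hsupr, hjbot]
end

section
/- Let A be a quantale with a·b ≤ a ⊓ b for all a, b ∈ A, and let j : A → A be a monotone map such that a ≤ j(a) for all a ∈ A, j(0) = 0, and j(x)·j(y) ≤ j(x·y) for all x, y ∈ A. Then ann(a) = ann(j(a)) for all a ∈ A. -/
theorem monotone_of_map_sSup {A B : Type*} [CompleteLattice A] [CompleteLattice B] (f : A → B)
    (h : ∀ X : Set A, f (sSup X) = sSup (f '' X)) : Monotone f := by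
  intro x y hxy
  have hy := h {x, y}
  rw [sSup_pair, sup_eq_right.2 hxy, Set.image_pair, sSup_pair] at hy
  exact hy ▸ le_sup_left

/-- Let `A` be a quantale with `a·b ≤ a ⊓ b`, and let `j : A → A` be monotone,
inflationary, with `j ⊥ = ⊥` and `j x · j y ≤ j (x·y)`.
Then `ann a = ann (j a)` for all `a ∈ A`. -/
theorem stmt_3 {A : Type*} [CompleteLattice A] (mul : A → A → A)
    -- quantale axioms
    (hassoc : ∀ a b c : A, mul (mul a b) c = mul a (mul b c))
    (hsupl : ∀ (a : A) (X : Set A), mul a (sSup X) = sSup ((fun x => mul a x) '' X))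
    (hsupr : ∀ (a : A) (X : Set A), mul (sSup X) a = sSup ((fun x => mul x a) '' X))
    -- the product lies below the meet
    (hmulinf : ∀ a b : A, mul a b ≤ a ⊓ b)
    -- the map `j`
    (j : A → A)
    (hjmono : Monotone j)
    (hjinfl : ∀ a : A, a ≤ j a)
    (hjbot : j ⊥ = ⊥)
    (hjmul : ∀ x y : A, mul (j x) (j y) ≤ j (mul x y))
    (a : A) :
    qann mul a = qann mul (j a) := by
  have hset : {x | mul x a = ⊥} = {x | mul x (j a) = ⊥} := by
    ext x
    have hl : Monotone fun y => mul x y := monotone_of_map_sSup _ (hsupl x)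
    have hr : Monotone fun y => mul y (j a) := monotone_of_map_sSup _ (hsupr (j a))
    constructor <;> intro hx <;> rw [Set.mem_ofPred_eq] at hx ⊢ <;> rw [← le_bot_iff]
    · calc
        mul x (j a) ≤ mul (j x) (j a) := hr (hjinfl x)
        _ ≤ j (mul x a) := hjmul x a
        _ = ⊥ := by rw [hx, hjbot]
    · exact (hl (hjinfl a)).trans hx.le
  rw [qann, qann, hset]
end

section
/- Let R be a ring and M a left R-module which generates all its fully invariant submodules. If N, L are fully invariant submodules of M with (N : L) = M, then L ≤ N. -/
/-- A submodule `N ≤ M` is fully invariant if `f(N) ⊆ N` for every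
endomorphism `f` of `M`. -/
def IsFullyInvariant {R M : Type*} [Ring R] [AddCommGroup M] [Module R M]
    (N : Submodule R M) : Prop :=
  ∀ f : M →ₗ[R] M, N.map f ≤ N

/-- `(N : L) = {m ∈ M | f(m) ∈ N for all f ∈ Hom_R(M, L)}`, where `Hom_R(M, L)`
is identified with the endomorphisms of `M` whose image is contained in `L`. -/
def colonFI {R M : Type*} [Ring R] [AddCommGroup M] [Module R M]
    (N L : Submodule R M) : Submodule R M where
  carrier := {m | ∀ f : M →ₗ[R] M, LinearMap.range f ≤ L → f m ∈ N}
  add_mem' := fun ha hb f hf => by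
    rw [map_add]; exact N.add_mem (ha f hf) (hb f hf)
  zero_mem' := fun f hf => by rw [map_zero]; exact N.zero_mem
  smul_mem' := fun c a ha f hf => by
    rw [map_smul]; exact N.smul_mem c (ha f hf)

/-- Let `M` generate all its fully invariant submodules
(`K = Σ {f(M) | f ∈ Hom_R(M, K)}` for every fully invariant `K ≤ M`).
If `N, L` are fully invariant with `(N : L) = M`, then `L ≤ N`. -/
theorem stmt_9 {R M : Type*} [Ring R] [AddCommGroup M] [Module R M]
    (hgen : ∀ K : Submodule R M, IsFullyInvariant K →
      K = ⨆ f ∈ {f : M →ₗ[R] M | LinearMap.range f ≤ K}, LinearMap.range f)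
    (N L : Submodule R M)
    (hN : IsFullyInvariant N) (hL : IsFullyInvariant L)
    (h : colonFI N L = ⊤) :
    L ≤ N := by
  rw [hgen L hL]
  refine iSup₂_le fun f hf => ?_
  rintro _ ⟨m, rfl⟩
  have hm : m ∈ colonFI N L := h ▸ Submodule.mem_top
  exact hm f hf
end

section
/- Let R be a ring and M a quasi-projective (self-projective) left R-module. Then (N : L) ∩ (N : K) ≤ (N : L + K) for all fully invariant submodules N, L, K of M; hence, combined with the reverse inclusion, (N : L + K) = (N : L) ∩ (N : K). -/
/-- `M` is quasi-projective (self-projective): every homomorphism `M → M/K`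
factors through the quotient map `M → M/K` via an endomorphism of `M`. -/
def IsSelfProjective (R M : Type*) [Ring R] [AddCommGroup M] [Module R M] : Prop :=
  ∀ (K : Submodule R M) (g : M →ₗ[R] M ⧸ K), ∃ h : M →ₗ[R] M, K.mkQ ∘ₗ h = g

/-- Over a self-projective module, an endomorphism with image in `L ⊔ K` is the sum of an
endomorphism with image in `L` and one with image in `K`. -/
theorem IsSelfProjective.exists_range_le_of_range_le_sup {R M : Type*} [Ring R] [AddCommGroup M]
    [Module R M] (hsp : IsSelfProjective R M) {L K : Submodule R M} {f : M →ₗ[R] M}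
    (hf : LinearMap.range f ≤ L ⊔ K) :
    ∃ g : M →ₗ[R] M, LinearMap.range g ≤ L ∧ LinearMap.range (f - g) ≤ K := by
  have hsplit (m : M) : ∃ l ∈ L, f m - l ∈ K := by
    obtain ⟨l, hl, k, hk, hlk⟩ := Submodule.mem_sup.1 (hf ⟨m, rfl⟩)
    exact ⟨l, hl, by rwa [← hlk, add_sub_cancel_left]⟩
  choose l hl hk using hsplit
  let φ : M →ₗ[R] M ⧸ (L ⊓ K) :=
    { toFun m := (L ⊓ K).mkQ (l m)
      map_add' x y := by
        rw [← map_add, ← sub_eq_zero, ← map_sub, Submodule.mkQ_apply,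
          Submodule.Quotient.mk_eq_zero]
        refine ⟨L.sub_mem (hl _) (L.add_mem (hl x) (hl y)), SetLike.mem_coe.2 ?_⟩
        have h := K.sub_mem (K.add_mem (hk x) (hk y)) (hk (x + y))
        rw [map_add] at h
        convert h using 1
        abel
      map_smul' c x := by
        rw [RingHom.id_apply, ← map_smul, ← sub_eq_zero, ← map_sub, Submodule.mkQ_apply,
          Submodule.Quotient.mk_eq_zero]
        refine ⟨L.sub_mem (hl _) (L.smul_mem c (hl x)), SetLike.mem_coe.2 ?_⟩
        have h := K.sub_mem (K.smul_mem c (hk x)) (hk (c • x))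
        rw [map_smul, smul_sub] at h
        convert h using 1
        abel }
  obtain ⟨g, hg⟩ := hsp (L ⊓ K) φ
  have hgl (m : M) : g m - l m ∈ L ⊓ K :=
    (Submodule.Quotient.eq _).1 (LinearMap.congr_fun hg m)
  refine ⟨g, ?_, ?_⟩
  · rintro _ ⟨m, rfl⟩
    exact (L.sub_mem_iff_left (hl m)).1 (hgl m).1
  · rintro _ ⟨m, rfl⟩
    simpa using K.sub_mem (hk m) (hgl m).2

theorem colonFI_anti_right {R M : Type*} [Ring R] [AddCommGroup M] [Module R M]
    (N : Submodule R M) {L L' : Submodule R M} (h : L ≤ L') : colonFI N L' ≤ colonFI N L :=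
  fun _ hm f hf => hm f (hf.trans h)

/-- If `M` is quasi-projective, then `(N : L) ∩ (N : K) ≤ (N : L + K)` for all
fully invariant `N, L, K`; hence, together with the reverse inclusion,
`(N : L + K) = (N : L) ∩ (N : K)`. -/
theorem stmt_10 {R M : Type*} [Ring R] [AddCommGroup M] [Module R M]
    (hsp : IsSelfProjective R M)
    (N L K : Submodule R M)
    (hN : IsFullyInvariant N) (hL : IsFullyInvariant L) (hK : IsFullyInvariant K) :
    colonFI N L ⊓ colonFI N K ≤ colonFI N (L ⊔ K) ∧
    colonFI N (L ⊔ K) = colonFI N L ⊓ colonFI N K := by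
  have hle : colonFI N L ⊓ colonFI N K ≤ colonFI N (L ⊔ K) := by
    rintro m ⟨hmL, hmK⟩ f hf
    obtain ⟨g, hg, hfg⟩ := hsp.exists_range_le_of_range_le_sup hf
    simpa using N.add_mem (hmL g hg) (hmK (f - g) hfg)
  exact ⟨hle, le_antisymm (le_inf (colonFI_anti_right N le_sup_left)
    (colonFI_anti_right N le_sup_right)) hle⟩
end

section
/- Let R be a ring and M a left R-module such that (N : L ∩ K) = (N : L) + (N : K) holds for all fully invariant submodules N, L, K of M (condition SDML2). Then (N : L) + (L : N) = M for all fully invariant submodules N, L of M (condition SDML). -/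
theorem IsFullyInvariant.inf {R M : Type*} [Ring R] [AddCommGroup M] [Module R M]
    {N L : Submodule R M} (hN : IsFullyInvariant N) (hL : IsFullyInvariant L) :
    IsFullyInvariant (N ⊓ L) := fun f =>
  le_inf ((Submodule.map_mono inf_le_left).trans (hN f))
    ((Submodule.map_mono inf_le_right).trans (hL f))

theorem colonFI_mono_left {R M : Type*} [Ring R] [AddCommGroup M] [Module R M]
    {N N' : Submodule R M} (h : N ≤ N') (L : Submodule R M) :
    colonFI N L ≤ colonFI N' L := fun _ hm f hf => h (hm f hf)

theorem colonFI_self {R M : Type*} [Ring R] [AddCommGroup M] [Module R M]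
    (N : Submodule R M) : colonFI N N = ⊤ :=
  eq_top_iff.2 fun m _ f hf => hf (LinearMap.mem_range_self f m)

/-- Suppose `(N : L ∩ K) = (N : L) + (N : K)` for all fully invariant
`N, L, K ≤ M` (condition SDML2).  Then `(N : L) + (L : N) = M` for all fully
invariant `N, L ≤ M` (condition SDML). -/
theorem stmt_11 {R M : Type*} [Ring R] [AddCommGroup M] [Module R M]
    (hsdml2 : ∀ N L K : Submodule R M,
      IsFullyInvariant N → IsFullyInvariant L → IsFullyInvariant K →
      colonFI N (L ⊓ K) = colonFI N L ⊔ colonFI N K)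
    (N L : Submodule R M)
    (hN : IsFullyInvariant N) (hL : IsFullyInvariant L) :
    colonFI N L ⊔ colonFI L N = ⊤ := by
  rw [eq_top_iff, ← colonFI_self (L ⊓ N), hsdml2 _ _ _ (hL.inf hN) hL hN]
  exact sup_le_sup (colonFI_mono_left inf_le_right L) (colonFI_mono_left inf_le_left N)
end

section
/- Let R be a ring and M a quasi-projective (self-projective) left R-module which generates all its fully invariant submodules. If (N : L ∩ K) = (N : L) + (N : K) holds for all fully invariant submodules N, L, K of M (condition SDML2), then the lattice of fully invariant submodules of M is distributive: N + (L ∩ K) = (N + L) ∩ (N + K) for all fully invariant submodules N, L, K of M. -/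
/-- If `M` is self-projective, an endomorphism with image in `N ⊔ L` is congruent modulo `N` to an
endomorphism with image in `L`. -/
theorem IsSelfProjective.exists_range_le_sub_mem {R M : Type*} [Ring R] [AddCommGroup M]
    [Module R M] (hsp : IsSelfProjective R M) {N L : Submodule R M} {f : M →ₗ[R] M}
    (hf : LinearMap.range f ≤ N ⊔ L) :
    ∃ g : M →ₗ[R] M, LinearMap.range g ≤ L ∧ ∀ m, f m - g m ∈ N := by
  have hex : ∀ m, ∃ l ∈ L, f m - l ∈ N := by
    intro m
    obtain ⟨n, hn, l, hl, h⟩ := Submodule.mem_sup.mp (hf ⟨m, rfl⟩)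
    exact ⟨l, hl, by rwa [← h, add_sub_cancel_right]⟩
  choose c hcL hcN using hex
  let φ : M →ₗ[R] M ⧸ (N ⊓ L) :=
    { toFun := fun m => (N ⊓ L).mkQ (c m)
      map_add' := fun a b => by
        rw [← map_add, Submodule.mkQ_apply, Submodule.mkQ_apply, Submodule.Quotient.eq]
        refine Submodule.mem_inf.mpr ⟨?_, L.sub_mem (hcL _) (L.add_mem (hcL a) (hcL b))⟩
        have h := N.sub_mem (N.add_mem (hcN a) (hcN b)) (hcN (a + b))
        rw [map_add] at h
        convert h using 1
        abel
      map_smul' := fun r a => by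
        rw [RingHom.id_apply, ← map_smul, Submodule.mkQ_apply, Submodule.mkQ_apply,
          Submodule.Quotient.eq]
        refine Submodule.mem_inf.mpr ⟨?_, L.sub_mem (hcL _) (L.smul_mem r (hcL a))⟩
        have h := N.sub_mem (N.smul_mem r (hcN a)) (hcN (r • a))
        rw [map_smul, smul_sub] at h
        convert h using 1
        abel }
  obtain ⟨g, hg⟩ := hsp (N ⊓ L) φ
  have hgc : ∀ m, g m - c m ∈ N ⊓ L := fun m =>
    (Submodule.Quotient.eq _).mp (LinearMap.congr_fun hg m)
  refine ⟨g, ?_, fun m => ?_⟩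
  · rintro _ ⟨m, rfl⟩
    simpa using L.add_mem (hgc m).2 (hcL m)
  · simpa using N.sub_mem (hcN m) (hgc m).1

theorem IsFullyInvariant.sup {R M : Type*} [Ring R] [AddCommGroup M] [Module R M]
    {N L : Submodule R M} (hN : IsFullyInvariant N) (hL : IsFullyInvariant L) :
    IsFullyInvariant (N ⊔ L) := fun f => by
  rw [Submodule.map_sup]
  exact sup_le_sup (hN f) (hL f)

/-- Over a self-projective module, endomorphisms with image in `N ⊔ L` send `(P : L)` into
`N ⊔ P`. -/
theorem IsSelfProjective.apply_mem_sup_of_mem_colonFI {R M : Type*} [Ring R] [AddCommGroup M]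
    [Module R M] (hsp : IsSelfProjective R M) {N L P : Submodule R M} {f : M →ₗ[R] M}
    (hf : LinearMap.range f ≤ N ⊔ L) {m : M} (hm : m ∈ colonFI P L) : f m ∈ N ⊔ P := by
  obtain ⟨g, hgL, hfg⟩ := hsp.exists_range_le_sub_mem hf
  simpa using Submodule.add_mem_sup (hfg m) (hm g hgL)

/-- Let `M` be quasi-projective and generate all its fully invariant submodules.
If SDML2 holds (`(N : L ∩ K) = (N : L) + (N : K)` for all fully invariant
`N, L, K`), then the lattice of fully invariant submodules is distributive:
`N + (L ∩ K) = (N + L) ∩ (N + K)`. -/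
theorem stmt_12 {R M : Type*} [Ring R] [AddCommGroup M] [Module R M]
    (hsp : IsSelfProjective R M)
    (hgen : ∀ K : Submodule R M, IsFullyInvariant K →
      K = ⨆ f ∈ {f : M →ₗ[R] M | LinearMap.range f ≤ K}, LinearMap.range f)
    (hsdml2 : ∀ N L K : Submodule R M,
      IsFullyInvariant N → IsFullyInvariant L → IsFullyInvariant K →
      colonFI N (L ⊓ K) = colonFI N L ⊔ colonFI N K)
    (N L K : Submodule R M)
    (hN : IsFullyInvariant N) (hL : IsFullyInvariant L) (hK : IsFullyInvariant K) :
    N ⊔ (L ⊓ K) = (N ⊔ L) ⊓ (N ⊔ K) := by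
  refine le_antisymm sup_inf_le ?_
  rw [hgen _ ((hN.sup hL).inf (hN.sup hK))]
  refine iSup₂_le fun f hf => ?_
  rintro _ ⟨m, rfl⟩
  have htop := hsdml2 (L ⊓ K) L K (hL.inf hK) hL hK
  rw [colonFI_self] at htop
  have hm : m ∈ colonFI (L ⊓ K) L ⊔ colonFI (L ⊓ K) K := htop ▸ Submodule.mem_top
  obtain ⟨a, ha, b, hb, rfl⟩ := Submodule.mem_sup.mp hm
  rw [map_add]
  exact Submodule.add_mem _
    (hsp.apply_mem_sup_of_mem_colonFI (le_trans hf inf_le_left) ha)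
    (hsp.apply_mem_sup_of_mem_colonFI (le_trans hf inf_le_right) hb)
end

section
/- Let R be a (left and right) Noetherian ring and let S be a multiplicatively closed subset of R consisting of regular elements (non-zero-divisors) satisfying the Ore condition, so that the Ore localization S⁻¹R (ring of left fractions s⁻¹a) exists. Then for all two-sided ideals I and J of R, (I^e :ℓ J^e) ⊆ (I :ℓ J)^e, where I^e = {s⁻¹a : s ∈ S, a ∈ I} denotes the extension of I in S⁻¹R and (A :ℓ B) = {x : xB ⊆ A}. -/
/-- `(A :ℓ B) = {x | x·B ⊆ A}`. -/
def colonSetL {α : Type*} [Mul α] (A B : Set α) : Set α :=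
  {x | ∀ b ∈ B, x * b ∈ A}

/-- The extension `I^e = {s⁻¹a | s ∈ S, a ∈ I}` of `I` in the ring of left
fractions: `q ∈ I^e` iff `f s * q = f a` for some `s ∈ S`, `a ∈ I`. -/
def extSet {R Q : Type*} [Ring R] [Ring Q] (f : R →+* Q) (S : Set R) (I : Set R) :
    Set Q :=
  {q | ∃ s ∈ S, ∃ a ∈ I, f s * q = f a}

/-- If `x * f b` lies in the extension of `I` for each `b` in a finite set, then one left
denominator of `x` works for all these `b` at once. -/
theorem exists_common_denominator {R Q : Type*} [Ring R] [Ring Q] (S : Submonoid R)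
    (hore : ∀ (a : R), ∀ s ∈ S, ∃ t ∈ S, ∃ b : R, t * a = b * s)
    (f : R →+* Q) (hinj : Function.Injective f)
    (hfrac : ∀ q : Q, ∃ s ∈ S, ∃ a : R, f s * q = f a)
    (I : TwoSidedIdeal R) (x : Q) {T : Set R} (hT : T.Finite)
    (hx : ∀ b ∈ T, x * f b ∈ extSet f S I) :
    ∃ t ∈ S, ∃ a : R, f t * x = f a ∧ ∀ b ∈ T, a * b ∈ I := by
  induction T, hT using Set.Finite.induction_on with
  | empty =>
    obtain ⟨s, hs, a, h⟩ := hfrac x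
    exact ⟨s, hs, a, h, by simp⟩
  | @insert b T _ _ ih =>
    obtain ⟨t, ht, a, hta, haT⟩ := ih fun b hb => hx b (Set.mem_insert_of_mem _ hb)
    obtain ⟨s, hs, c, hc, hsc⟩ := hx b (Set.mem_insert _ _)
    obtain ⟨u, hu, v, huv⟩ := hore t s hs
    have hua : f (u * t) * x = f (u * a) := by rw [map_mul, mul_assoc, hta, map_mul]
    refine ⟨u * t, S.mul_mem hu ht, u * a, hua, ?_⟩
    rintro d (rfl | hd)
    · have h : u * a * d = v * c := hinj <| by
        rw [map_mul, ← hua, huv, map_mul, map_mul, ← hsc]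
        simp only [mul_assoc]
      rw [h]
      exact I.mul_mem_left _ _ hc
    · rw [mul_assoc]
      exact I.mul_mem_left _ _ (haT d hd)

/-- Over a right Noetherian ring, every two-sided ideal `J` contains a finite set `T` such that
any two-sided ideal `I` containing `a * T` contains `a * J`. -/
theorem TwoSidedIdeal.exists_finite_right_generators {R : Type*} [Ring R]
    [IsNoetherianRing Rᵐᵒᵖ] (J : TwoSidedIdeal R) :
    ∃ T : Set R, T.Finite ∧ T ⊆ J ∧
      ∀ (I : TwoSidedIdeal R) (a : R), (∀ b ∈ T, a * b ∈ I) → ∀ b ∈ J, a * b ∈ I := by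
  let K : Ideal Rᵐᵒᵖ :=
    { carrier := {r | r.unop ∈ J}
      add_mem' := fun hr hs => J.add_mem hr hs
      zero_mem' := J.zero_mem
      smul_mem' := fun c _ hr => J.mul_mem_right _ c.unop hr }
  obtain ⟨G, hG⟩ := IsNoetherian.noetherian K
  refine ⟨MulOpposite.unop '' (G : Set Rᵐᵒᵖ), G.finite_toSet.image _, ?_, ?_⟩
  · rintro _ ⟨g, hg, rfl⟩
    have h : g ∈ K := hG ▸ Submodule.subset_span hg
    exact h
  · intro I a ha b hb
    let L : Ideal Rᵐᵒᵖ :=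
      { carrier := {r | a * r.unop ∈ I}
        add_mem' := fun {r s} hr hs => by
          simpa [mul_add] using I.add_mem hr hs
        zero_mem' := by simp [I.zero_mem]
        smul_mem' := fun c r hr => by
          simpa [mul_assoc] using I.mul_mem_right _ c.unop hr }
    have hKL : K ≤ L := by
      rw [← hG, Submodule.span_le]
      exact fun g hg => ha _ ⟨g, hg, rfl⟩
    have h : MulOpposite.op b ∈ L := hKL hb
    exact h

/-- Let `R` be a left and right Noetherian ring and `S` a multiplicatively
closed set of regular elements satisfying the (left) Ore condition, so that the
ring `Q = S⁻¹R` of left fractions exists.  Then for all two-sided ideals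
`I, J` of `R`, `(I^e :ℓ J^e) ⊆ (I :ℓ J)^e`. -/
theorem stmt_13 {R Q : Type*} [Ring R] [Ring Q]
    [IsNoetherianRing R] [IsNoetherianRing Rᵐᵒᵖ]
    (S : Submonoid R)
    (hreg : ∀ s ∈ S, IsRegular s)
    (hore : ∀ (a : R), ∀ s ∈ S, ∃ t ∈ S, ∃ b : R, t * a = b * s)
    -- `Q` is the ring of left fractions `S⁻¹R`, with `R ⊆ Q` via `f`
    (f : R →+* Q)
    (hinj : Function.Injective f)
    (hunit : ∀ s ∈ S, IsUnit (f s))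
    (hfrac : ∀ q : Q, ∃ s ∈ S, ∃ a : R, f s * q = f a)
    (I J : TwoSidedIdeal R) :
    colonSetL (extSet f S I) (extSet f S J) ⊆ extSet f S (colonSetL I J) := by
  intro x hx
  obtain ⟨T, hT, hTJ, hgen⟩ := J.exists_finite_right_generators
  obtain ⟨t, ht, a, hta, haT⟩ :=
    exists_common_denominator S hore f hinj hfrac I x hT fun b hb =>
      hx (f b) ⟨1, S.one_mem, b, hTJ hb, by simp⟩
  exact ⟨t, ht, a, hgen I a haT, hta⟩
end

section
/- Let R be a (left and right) Noetherian ring such that every maximal ideal P of R is localizable, i.e., the set C_R(P) of elements of R that are regular modulo P satisfies the Ore conditions so that the Ore localization R_P of R at C_R(P) exists. If I and J are two-sided ideals of R such that the extensions IR_P and JR_P coincide in R_P for every maximal ideal P of R, then I = J. -/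
/-- The set `C_R(P)` of elements of `R` that are regular modulo the two-sided
ideal `P`, i.e. whose image in `R/P` is a regular element. -/
def regModSet {R : Type*} [Ring R] (P : TwoSidedIdeal R) : Set R :=
  {c | (∀ x : R, c * x ∈ P → x ∈ P) ∧ (∀ x : R, x * c ∈ P → x ∈ P)}

/-- `f : R →+* Q` presents `Q` as the Ore localization `S⁻¹R` of left
fractions: `S` satisfies the left Ore condition, the elements of `S` become
units, every element of `Q` is a left fraction `(f s)⁻¹ (f a)`, and the kernel
of `f` is `{a | s·a = 0 for some s ∈ S}`. -/
structure IsLeftOreLocalization {R Q : Type*} [Ring R] [Ring Q]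
    (S : Set R) (f : R →+* Q) : Prop where
  ore : ∀ (a : R), ∀ s ∈ S, ∃ t ∈ S, ∃ b : R, t * a = b * s
  isUnit : ∀ s ∈ S, IsUnit (f s)
  frac : ∀ q : Q, ∃ s ∈ S, ∃ a : R, f s * q = f a
  ker : ∀ a : R, f a = 0 ↔ ∃ s ∈ S, s * a = 0

/-- The elements regular modulo a two-sided ideal form a multiplicative submonoid. -/
def regModSubmonoid {R : Type*} [Ring R] (P : TwoSidedIdeal R) : Submonoid R where
  carrier := regModSet P
  one_mem' := by
    constructor <;> intro x hx <;> simpa using hx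
  mul_mem' := by
    rintro a b ⟨ha, ha'⟩ ⟨hb, hb'⟩
    refine ⟨fun x hx => hb x (ha _ ?_), fun x hx => ha' x (hb' _ ?_)⟩
    · simpa [mul_assoc] using hx
    · simpa [mul_assoc] using hx

/-- The left Ore condition for a submonoid. -/
def LeftOre {R : Type*} [Ring R] (S : Submonoid R) : Prop :=
  ∀ (a : R), ∀ s ∈ S, ∃ t ∈ S, ∃ b : R, t * a = b * s

namespace LeftOre

variable {R : Type*} [Ring R] {S : Submonoid R}

/-- The left ideal of those `a` such that `t * a` lies in `L` for some `t ∈ S`. -/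
def saturation (hS : LeftOre S) (L : Ideal R) : Ideal R where
  carrier := {a | ∃ t ∈ S, t * a ∈ L}
  zero_mem' := ⟨1, S.one_mem, by simp⟩
  add_mem' := by
    rintro a b ⟨t, ht, hta⟩ ⟨u, hu, hub⟩
    obtain ⟨v, hv, c, hvc⟩ := hS t u hu
    refine ⟨v * t, S.mul_mem hv ht, ?_⟩
    rw [mul_add]
    refine L.add_mem ?_ ?_
    · rw [mul_assoc]
      exact L.mul_mem_left v hta
    · rw [hvc, mul_assoc]
      exact L.mul_mem_left c hub
  smul_mem' := by
    rintro x a ⟨t, ht, hta⟩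
    obtain ⟨v, hv, c, hvc⟩ := hS x t ht
    refine ⟨v, hv, ?_⟩
    rw [smul_eq_mul, ← mul_assoc, hvc, mul_assoc]
    exact L.mul_mem_left c hta

theorem mem_saturation (hS : LeftOre S) {L : Ideal R} {a : R} :
    a ∈ hS.saturation L ↔ ∃ t ∈ S, t * a ∈ L :=
  Iff.rfl

theorem mem_saturation_of_mul_mem (hS : LeftOre S) {L : Ideal R} {s a : R} (hs : s ∈ S)
    (h : s * a ∈ hS.saturation L) : a ∈ hS.saturation L := by
  obtain ⟨t, ht, hta⟩ := h
  exact ⟨t * s, S.mul_mem ht hs, by rwa [mul_assoc]⟩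

theorem saturation_mul_mem_right (hS : LeftOre S) (J : TwoSidedIdeal R) {a : R} (x : R)
    (h : a ∈ hS.saturation J.asIdeal) : a * x ∈ hS.saturation J.asIdeal := by
  obtain ⟨t, ht, hta⟩ := h
  refine ⟨t, ht, ?_⟩
  rw [← mul_assoc]
  exact J.mul_mem_right _ _ hta

/-- Over a left Noetherian ring, the saturation of a two-sided ideal is also saturated under
right cancellation of elements of `S`. -/
theorem mem_saturation_of_mul_mem_right [IsNoetherianRing R] (hS : LeftOre S)
    (J : TwoSidedIdeal R) {s a : R} (hs : s ∈ S)
    (h : a * s ∈ hS.saturation J.asIdeal) : a ∈ hS.saturation J.asIdeal := by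
  let K : ℕ →o Ideal R :=
    { toFun := fun n =>
        Submodule.comap (LinearMap.toSpanSingleton R R (s ^ n)) (hS.saturation J.asIdeal)
      monotone' := monotone_nat_of_le_succ fun n x hx => by
        have hx' : x * s ^ n ∈ hS.saturation J.asIdeal := hx
        change x * s ^ (n + 1) ∈ hS.saturation J.asIdeal
        rw [pow_succ, ← mul_assoc]
        exact hS.saturation_mul_mem_right J s hx' }
  obtain ⟨n, hn⟩ := monotone_stabilizes_iff_noetherian.mpr ‹IsNoetherianRing R› K
  obtain ⟨t, ht, b, hb⟩ := hS a (s ^ n) (S.pow_mem hs n)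
  have hmem : b ∈ K (n + 1) := by
    change b * s ^ (n + 1) ∈ hS.saturation J.asIdeal
    rw [pow_succ, ← mul_assoc, ← hb, mul_assoc]
    exact Ideal.mul_mem_left _ t h
  rw [← hn (n + 1) n.le_succ] at hmem
  refine hS.mem_saturation_of_mul_mem ht ?_
  rw [hb]
  exact hmem

/-- Finitely many elements of the saturation of `L` have a common left multiplier in `S`
moving them into `L`. -/
theorem exists_common_mul_mem (hS : LeftOre S) (L : Ideal R) (F : Finset Rᵐᵒᵖ)
    (hF : ∀ x ∈ F, x.unop ∈ hS.saturation L) : ∃ s ∈ S, ∀ x ∈ F, s * x.unop ∈ L := by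
  classical
  induction F using Finset.induction_on with
  | empty => exact ⟨1, S.one_mem, by simp⟩
  | insert a F _ ih =>
    obtain ⟨s, hs, hsF⟩ := ih fun x hx => hF x (Finset.mem_insert_of_mem hx)
    obtain ⟨t, ht, hta⟩ := hF a (Finset.mem_insert_self a F)
    obtain ⟨v, hv, c, hvc⟩ := hS t s hs
    refine ⟨v * t, S.mul_mem hv ht, fun x hx => ?_⟩
    rcases Finset.mem_insert.mp hx with rfl | hx
    · rw [mul_assoc]
      exact L.mul_mem_left v hta
    · rw [hvc, mul_assoc]
      exact L.mul_mem_left c (hsF x hx)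

/-- Over a right Noetherian ring, a two-sided ideal contained in the saturation of `J` is moved
into `J` by a single element of `S`. -/
theorem exists_mul_mem_of_le_saturation [IsNoetherianRing Rᵐᵒᵖ] (hS : LeftOre S)
    (I J : TwoSidedIdeal R) (h : ∀ a ∈ I, a ∈ hS.saturation J.asIdeal) :
    ∃ s ∈ S, ∀ a ∈ I, s * a ∈ J := by
  obtain ⟨F, hF⟩ := IsNoetherian.noetherian I.asIdealOpposite
  obtain ⟨s, hs, hsF⟩ := hS.exists_common_mul_mem J.asIdeal F fun x hx =>
    h _ (TwoSidedIdeal.mem_asIdealOpposite.mp (hF ▸ Submodule.subset_span hx))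
  refine ⟨s, hs, fun a ha => ?_⟩
  have hspan : MulOpposite.op a ∈ Submodule.span Rᵐᵒᵖ (F : Set Rᵐᵒᵖ) := by
    rw [hF]
    exact TwoSidedIdeal.mem_asIdealOpposite.mpr ha
  have key : ∀ y ∈ Submodule.span Rᵐᵒᵖ (F : Set Rᵐᵒᵖ), s * y.unop ∈ J := by
    intro y hy
    induction hy using Submodule.span_induction with
    | mem x hx => exact hsF x hx
    | zero => simp
    | add x y _ _ hx hy =>
      rw [MulOpposite.unop_add, mul_add]
      exact J.add_mem hx hy
    | smul r x _ hx =>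
      rw [smul_eq_mul, MulOpposite.unop_mul, ← mul_assoc]
      exact J.mul_mem_right _ _ hx
  exact key _ hspan

end LeftOre

namespace IsLeftOreLocalization

variable {R Q : Type*} [Ring R] [Ring Q] {S : Submonoid R} {f : R →+* Q}

theorem leftOre (hf : IsLeftOreLocalization (S : Set R) f) : LeftOre S :=
  hf.ore

theorem mem_saturation_of_map_eq (hf : IsLeftOreLocalization (S : Set R) f) {L : Ideal R}
    {a b : R} (hab : f a = f b) (hb : b ∈ hf.leftOre.saturation L) :
    a ∈ hf.leftOre.saturation L := by
  obtain ⟨t, ht, h⟩ := (hf.ker (a - b)).mp (by rw [map_sub, hab, sub_self])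
  refine hf.leftOre.mem_saturation_of_mul_mem ht ?_
  rw [mul_sub, sub_eq_zero] at h
  rw [h]
  exact Ideal.mul_mem_left _ t hb

/-- The extension of a two-sided ideal of a left Noetherian ring, as the ideal of left fractions
with numerator in its saturation. -/
def extension [IsNoetherianRing R] (hf : IsLeftOreLocalization (S : Set R) f)
    (J : TwoSidedIdeal R) : TwoSidedIdeal Q :=
  .mk' {q | ∃ s ∈ S, ∃ a ∈ hf.leftOre.saturation J.asIdeal, f s * q = f a}
    ⟨1, S.one_mem, 0, Ideal.zero_mem _, by simp⟩
    (by
      rintro q p ⟨s, hs, a, ha, hq⟩ ⟨u, hu, b, hb, hp⟩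
      obtain ⟨v, hv, c, hvc⟩ := hf.leftOre s u hu
      refine ⟨v * s, S.mul_mem hv hs, v * a + c * b,
        Ideal.add_mem _ (Ideal.mul_mem_left _ v ha) (Ideal.mul_mem_left _ c hb), ?_⟩
      rw [mul_add, map_add]
      congr 1
      · rw [map_mul, mul_assoc, hq, map_mul]
      · rw [hvc, map_mul, mul_assoc, hp, map_mul])
    (by
      rintro q ⟨s, hs, a, ha, hq⟩
      exact ⟨s, hs, -a, Submodule.neg_mem _ ha, by rw [mul_neg, hq, map_neg]⟩)
    (by
      rintro x q ⟨s, hs, a, ha, hq⟩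
      obtain ⟨u, hu, b, hx⟩ := hf.frac x
      obtain ⟨t, ht, c, htc⟩ := hf.leftOre b s hs
      refine ⟨t * u, S.mul_mem ht hu, c * a, Ideal.mul_mem_left _ c ha, ?_⟩
      calc f (t * u) * (x * q) = f t * (f u * x) * q := by rw [map_mul]; simp only [mul_assoc]
        _ = f c * (f s * q) := by rw [hx, ← map_mul, htc, map_mul, mul_assoc]
        _ = f (c * a) := by rw [hq, map_mul])
    (by
      rintro q x ⟨s, hs, a, ha, hq⟩
      obtain ⟨u, hu, b, hx⟩ := hf.frac x
      obtain ⟨v, hv, c, hvc⟩ := hf.leftOre a u hu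
      have hc : c ∈ hf.leftOre.saturation J.asIdeal :=
        hf.leftOre.mem_saturation_of_mul_mem_right J hu (hvc ▸ Ideal.mul_mem_left _ v ha)
      refine ⟨v * s, S.mul_mem hv hs, c * b, hf.leftOre.saturation_mul_mem_right J b hc, ?_⟩
      calc f (v * s) * (q * x) = f v * (f s * q) * x := by rw [map_mul]; simp only [mul_assoc]
        _ = f c * (f u * x) := by rw [hq, ← map_mul, hvc, map_mul, mul_assoc]
        _ = f (c * b) := by rw [hx, map_mul])

theorem map_mem_extension_iff [IsNoetherianRing R] (hf : IsLeftOreLocalization (S : Set R) f)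
    (J : TwoSidedIdeal R) (a : R) :
    f a ∈ hf.extension J ↔ a ∈ hf.leftOre.saturation J.asIdeal := by
  rw [extension, TwoSidedIdeal.mem_mk']
  constructor
  · rintro ⟨s, hs, b, hb, h⟩
    rw [← map_mul] at h
    exact hf.leftOre.mem_saturation_of_mul_mem hs (hf.mem_saturation_of_map_eq h hb)
  · intro ha
    exact ⟨1, S.one_mem, a, ha, by simp⟩

/-- An element whose image lies in the extension of a two-sided ideal `J` is moved into `J` by
left multiplication by some denominator. -/
theorem mem_saturation_of_map_mem_span [IsNoetherianRing R]
    (hf : IsLeftOreLocalization (S : Set R) f) (J : TwoSidedIdeal R) {a : R}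
    (ha : f a ∈ TwoSidedIdeal.span (f '' J)) : a ∈ hf.leftOre.saturation J.asIdeal := by
  have hle : TwoSidedIdeal.span (f '' J) ≤ hf.extension J := by
    rw [TwoSidedIdeal.span_le]
    rintro _ ⟨j, hj, rfl⟩
    exact (hf.map_mem_extension_iff J j).mpr ⟨1, S.one_mem, by simpa using hj⟩
  exact (hf.map_mem_extension_iff J a).mp (hle ha)

end IsLeftOreLocalization

namespace TwoSidedIdeal

variable {R : Type*} [Ring R]

/-- The two-sided ideal of all `r` with `r * I ⊆ J`. -/
def leftColon (I J : TwoSidedIdeal R) : TwoSidedIdeal R :=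
  .mk' {r | ∀ a ∈ I, r * a ∈ J}
    (fun a _ => by simp)
    (fun hx hy a ha => by
      rw [add_mul]
      exact J.add_mem (hx a ha) (hy a ha))
    (fun hx a ha => by
      rw [neg_mul]
      exact J.neg_mem (hx a ha))
    (fun hy a ha => by
      rw [mul_assoc]
      exact J.mul_mem_left _ _ (hy a ha))
    (fun hx a ha => by
      rw [mul_assoc]
      exact hx _ (I.mul_mem_left _ _ ha))

theorem mem_leftColon {I J : TwoSidedIdeal R} {r : R} :
    r ∈ leftColon I J ↔ ∀ a ∈ I, r * a ∈ J := by
  rw [leftColon, mem_mk']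
  rfl

theorem isCoatomic_of_isNoetherianRing [IsNoetherianRing R] : IsCoatomic (TwoSidedIdeal R) := by
  have hmono : StrictMono (asIdeal : TwoSidedIdeal R → Ideal R) := fun _ _ h => h
  have : WellFoundedGT (TwoSidedIdeal R) := hmono.wellFoundedGT
  exact isCoatomic_of_orderTop_gt_wellFounded wellFounded_gt

theorem le_of_forall_isCoatom_exists_mul_mem [IsNoetherianRing R] (I J : TwoSidedIdeal R)
    (h : ∀ P : TwoSidedIdeal R, IsCoatom P → ∃ s ∈ regModSet P, ∀ a ∈ I, s * a ∈ J) :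
    I ≤ J := by
  have := isCoatomic_of_isNoetherianRing (R := R)
  rcases eq_top_or_exists_le_coatom (leftColon I J) with htop | ⟨P, hP, hle⟩
  · intro a ha
    simpa using mem_leftColon.mp ((one_mem_iff _).mpr htop) a ha
  · obtain ⟨s, hs, hsI⟩ := h P hP
    refine absurd ((one_mem_iff P).mp (hs.1 1 ?_)) hP.1
    rw [mul_one]
    exact hle (mem_leftColon.mpr hsI)

end TwoSidedIdeal

/-- Let `R` be a left and right Noetherian ring such that every maximal
(two-sided) ideal `P` is localizable.  If `I, J` are two-sided ideals whose
extensions `I R_P` and `J R_P` agree for every maximal ideal `P`, then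
`I = J`. -/
theorem stmt_14 {R : Type*} [Ring R]
    [IsNoetherianRing R] [IsNoetherianRing Rᵐᵒᵖ]
    -- every maximal two-sided ideal is localizable
    (hloc : ∀ P : TwoSidedIdeal R, IsCoatom P →
      ∃ (Q : Type) (_ : Ring Q), ∃ f : R →+* Q, IsLeftOreLocalization (regModSet P) f)
    (I J : TwoSidedIdeal R)
    -- the extensions `I R_P` and `J R_P` coincide for every maximal ideal `P`
    (hext : ∀ P : TwoSidedIdeal R, IsCoatom P →
      ∀ (Q : Type) [Ring Q], ∀ f : R →+* Q, IsLeftOreLocalization (regModSet P) f →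
      TwoSidedIdeal.span (f '' I) = TwoSidedIdeal.span (f '' J)) :
    I = J := by
  have key : ∀ A B : TwoSidedIdeal R,
      (∀ P : TwoSidedIdeal R, IsCoatom P →
        ∀ (Q : Type) [Ring Q], ∀ f : R →+* Q, IsLeftOreLocalization (regModSet P) f →
        TwoSidedIdeal.span (f '' A) = TwoSidedIdeal.span (f '' B)) → A ≤ B := by
    intro A B hAB
    refine TwoSidedIdeal.le_of_forall_isCoatom_exists_mul_mem A B fun P hP => ?_
    obtain ⟨Q, _, f, hf⟩ := hloc P hP
    have hf' : IsLeftOreLocalization (regModSubmonoid P : Set R) f := hf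
    refine hf'.leftOre.exists_mul_mem_of_le_saturation A B fun a ha =>
      hf'.mem_saturation_of_map_mem_span B ?_
    rw [← hAB P hP Q f hf]
    exact TwoSidedIdeal.subset_span ⟨a, ha, rfl⟩
  exact le_antisymm (key I J hext) (key J I fun P hP Q _ f hf => (hext P hP Q f hf).symm)
end

section
/- Let R be a prime (left and right) Noetherian ring whose set of regular elements satisfies the Ore conditions, so that the classical quotient ring Q = Q_cl(R) exists and R ⊆ Q. Suppose that each two-sided ideal A of R can be written as Rc₁ + ⋯ + Rc_m = A = d₁R + ⋯ + d_nR where each Rc_j and each d_iR is a two-sided ideal of R. If the product of two-sided ideals of R is commutative (IJ = JI for all ideals I, J) and R satisfies SDML, i.e., (A :ℓ B) + (B :ℓ A) = R for all two-sided ideals A, B, then every nonzero two-sided ideal of R is invertible; that is, R is an Asano prime ring. -/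
/-- The product of two-sided ideals: the two-sided ideal generated by the
products `a * b` with `a ∈ I`, `b ∈ J`. -/
def prodTI {R : Type*} [Ring R] (I J : TwoSidedIdeal R) : TwoSidedIdeal R :=
  TwoSidedIdeal.span {x | ∃ a ∈ I, ∃ b ∈ J, x = a * b}

/-- An additive subgroup `X` of `Q` is an `R`-sub-bimodule (via `f : R →+* Q`)
if it is closed under left and right multiplication by elements of `R`. -/
def IsSubBimodule {R Q : Type*} [Ring R] [Ring Q] (f : R →+* Q)
    (X : AddSubgroup Q) : Prop :=
  ∀ r : R, ∀ x ∈ X, f r * x ∈ X ∧ x * f r ∈ X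

/-- The product of two additive subgroups of a ring: the additive subgroup
generated by the products. -/
def mulGrp {Q : Type*} [Ring Q] (X Y : AddSubgroup Q) : AddSubgroup Q :=
  AddSubgroup.closure {q | ∃ x ∈ X, ∃ y ∈ Y, q = x * y}

/-- A two-sided ideal `I` of `R` is invertible (inside `Q ⊇ R`) if there is an
`R`-sub-bimodule `X` of `Q` with `X·I = R = I·X`. -/
def IsInvertibleIdeal {R Q : Type*} [Ring R] [Ring Q] (f : R →+* Q)
    (I : TwoSidedIdeal R) : Prop :=
  ∃ X : AddSubgroup Q, IsSubBimodule f X ∧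
    mulGrp X (AddSubgroup.closure (f '' I)) = AddSubgroup.closure (Set.range f) ∧
    mulGrp (AddSubgroup.closure (f '' I)) X = AddSubgroup.closure (Set.range f)

section Semigroup

variable {S : Type*} [Semigroup S]

/-- `x` is a bimodule over `o`. -/
structure IsBimod (o x : S) : Prop where
  left : o * x = x
  right : x * o = x

/-- `m` has a left inverse relative to `o` which is an `o`-bimodule. -/
def HasLeftInv (o m : S) : Prop := ∃ x, IsBimod o x ∧ x * m = o

/-- `m` has a right inverse relative to `o` which is an `o`-bimodule. -/
def HasRightInv (o m : S) : Prop := ∃ x, IsBimod o x ∧ m * x = o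

theorem IsBimod.mul {o x y : S} (hx : IsBimod o x) (hy : IsBimod o y) : IsBimod o (x * y) :=
  ⟨by rw [← mul_assoc, hx.left], by rw [mul_assoc, hy.right]⟩

theorem HasLeftInv.mul {o a b : S} (ha : HasLeftInv o a) (hb : HasLeftInv o b) :
    HasLeftInv o (a * b) := by
  obtain ⟨x, hx, hxa⟩ := ha
  obtain ⟨y, hy, hyb⟩ := hb
  exact ⟨y * x, hy.mul hx, by rw [mul_assoc, ← mul_assoc x, hxa, ← mul_assoc, hy.right, hyb]⟩

theorem HasRightInv.mul {o a b : S} (ha : HasRightInv o a) (hb : HasRightInv o b) :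
    HasRightInv o (a * b) := by
  obtain ⟨x, hx, hxa⟩ := ha
  obtain ⟨y, hy, hyb⟩ := hb
  exact ⟨y * x, hy.mul hx, by rw [mul_assoc, ← mul_assoc b, hyb, hx.left, hxa]⟩

theorem HasLeftInv.of_mul {o a b : S} (hb : IsBimod o b) (h : HasLeftInv o (b * a)) :
    HasLeftInv o a := by
  obtain ⟨x, hx, hxa⟩ := h
  exact ⟨x * b, hx.mul hb, by rw [mul_assoc, hxa]⟩

theorem HasRightInv.of_mul {o a b : S} (hb : IsBimod o b) (h : HasRightInv o (a * b)) :
    HasRightInv o a := by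
  obtain ⟨x, hx, hxa⟩ := h
  exact ⟨b * x, hb.mul hx, by rw [← mul_assoc, hxa]⟩

theorem exists_two_sided_inv {o a : S} (hl : HasLeftInv o a) (hr : HasRightInv o a) :
    ∃ x, IsBimod o x ∧ x * a = o ∧ a * x = o := by
  obtain ⟨x, hx, hxa⟩ := hl
  obtain ⟨y, hy, hay⟩ := hr
  have : x = y := by rw [← hx.right, ← hay, ← mul_assoc, hxa, hy.left]
  exact ⟨x, hx, hxa, this ▸ hay⟩

end Semigroup

section Regular

/-- In a prime left Noetherian ring, a nonzero element generating a two-sided ideal as a left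
ideal is regular. -/
theorem isRegular_of_mul_left_closed {R : Type*} [Ring R] [IsNoetherianRing R]
    (hprime : ∀ a b : R, (∀ r, a * r * b = 0) → a = 0 ∨ b = 0) {c : R} (hc : c ≠ 0)
    (hcR : ∀ t, ∃ r, c * t = r * c) : IsRegular c := by
  have hl : ∀ x, c * x = 0 → x = 0 := fun x hx ↦ by
    refine (hprime c x fun r ↦ ?_).resolve_left hc
    obtain ⟨s, hs⟩ := hcR r
    rw [hs, mul_assoc, hx, mul_zero]
  have hlpow : ∀ n : ℕ, ∀ x, c ^ n * x = 0 → x = 0 := fun n ↦ by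
    induction n with
    | zero => simp
    | succ n ih => exact fun x hx ↦ hl x (ih _ (by rwa [pow_succ, mul_assoc] at hx))
  have hpow : ∀ n : ℕ, ∀ t, ∃ r, c ^ n * t = r * c ^ n := fun n ↦ by
    induction n with
    | zero => exact fun t ↦ ⟨t, by simp⟩
    | succ n ih =>
      intro t
      obtain ⟨s, hs⟩ := hcR t
      obtain ⟨r, hr⟩ := ih s
      exact ⟨r, by rw [pow_succ, mul_assoc, hs, ← mul_assoc, hr, mul_assoc]⟩
  let g : R →ₗ[R] R := LinearMap.toSpanSingleton R R c
  have hg : ∀ (n : ℕ) x, (g ^ n) x = x * c ^ n := fun n ↦ by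
    induction n with
    | zero => simp
    | succ n ih => intro x; rw [pow_succ, Module.End.mul_apply, ih]; simp [g, pow_succ', mul_assoc]
  obtain ⟨n, hn⟩ := (Module.End.eventually_disjoint_ker_pow_range_pow g).exists_forall_of_atTop
  have hd := hn (n + 1) n.le_succ
  rw [Submodule.disjoint_def] at hd
  refine ⟨isLeftRegular_iff_right_eq_zero_of_mul.mpr hl,
    isRightRegular_iff_left_eq_zero_of_mul.mpr fun x hx ↦ hlpow (n + 1) x (hd _ ?_ ?_)⟩
  · rw [LinearMap.mem_ker, hg, mul_assoc, pow_succ', ← mul_assoc x, hx, zero_mul, mul_zero]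
  · obtain ⟨r, hr⟩ := hpow (n + 1) x
    exact ⟨r, by rw [hg, hr]⟩

/-- In a prime right Noetherian ring, a nonzero element generating a two-sided ideal as a right
ideal is regular. -/
theorem isRegular_of_mul_right_closed {R : Type*} [Ring R] [IsNoetherianRing Rᵐᵒᵖ]
    (hprime : ∀ a b : R, (∀ r, a * r * b = 0) → a = 0 ∨ b = 0) {d : R} (hd : d ≠ 0)
    (hRd : ∀ t, ∃ r, t * d = d * r) : IsRegular d := by
  have := isRegular_of_mul_left_closed (R := Rᵐᵒᵖ) (c := .op d)
    (fun a b h ↦ by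
      have := hprime b.unop a.unop fun r ↦ by
        simpa [mul_assoc] using congrArg MulOpposite.unop (h (.op r))
      simpa [or_comm] using this)
    (by simpa using hd)
    (fun t ↦ by
      obtain ⟨r, hr⟩ := hRd t.unop
      exact ⟨.op r, MulOpposite.unop_injective (by simpa using hr)⟩)
  exact ⟨fun x y h ↦ MulOpposite.op_injective (this.right (MulOpposite.unop_injective h)),
    fun x y h ↦ MulOpposite.op_injective (this.left (MulOpposite.unop_injective h))⟩

end Regular

section TwoSidedIdeal

variable {R Q : Type*} [Ring R] [Ring Q]

theorem mem_prodTI_iff {I J : TwoSidedIdeal R} {x : R} :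
    x ∈ prodTI I J ↔ x ∈ AddSubgroup.closure {x | ∃ a ∈ I, ∃ b ∈ J, x = a * b} := by
  refine TwoSidedIdeal.mem_span_iff_mem_addSubgroup_closure_absorbing ?_ ?_
  · rintro r _ ⟨a, ha, b, hb, rfl⟩
    exact ⟨r * a, I.mul_mem_left _ _ ha, b, hb, (mul_assoc _ _ _).symm⟩
  · rintro _ r ⟨a, ha, b, hb, rfl⟩
    exact ⟨a, ha, b * r, J.mul_mem_right _ _ hb, mul_assoc _ _ _⟩

theorem eq_zero_or_eq_zero_of_prime
    (hprime : ∀ I J : TwoSidedIdeal R, prodTI I J = ⊥ → I = ⊥ ∨ J = ⊥) (a b : R)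
    (h : ∀ r, a * r * b = 0) : a = 0 ∨ b = 0 := by
  have key : ∀ x ∈ TwoSidedIdeal.span {a}, ∀ y ∈ TwoSidedIdeal.span {b}, x * y = 0 := by
    have h₁ : ∀ x ∈ TwoSidedIdeal.span {a}, ∀ r, x * r * b = 0 := fun x hx ↦ by
      induction hx using TwoSidedIdeal.span_induction with
      | mem x hx => rw [Set.mem_singleton_iff.mp hx]; exact h
      | zero => simp
      | add x y _ _ hx hy => intro r; rw [add_mul, add_mul, hx, hy, add_zero]
      | neg x _ hx => intro r; rw [neg_mul, neg_mul, hx, neg_zero]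
      | left_absorb s x _ hx => intro r; rw [mul_assoc s, mul_assoc s, hx, mul_zero]
      | right_absorb s x _ hx => intro r; rw [mul_assoc x, hx]
    intro x hx y hy
    suffices ∀ r, x * r * y = 0 by simpa using this 1
    induction hy using TwoSidedIdeal.span_induction with
    | mem y hy => rw [Set.mem_singleton_iff.mp hy]; exact h₁ x hx
    | zero => simp
    | add y z _ _ hy hz => intro r; rw [mul_add, hy, hz, add_zero]
    | neg y _ hy => intro r; rw [mul_neg, hy, neg_zero]
    | left_absorb s y _ hy => intro r; rw [← mul_assoc, mul_assoc x, hy]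
    | right_absorb s y _ hy => intro r; rw [← mul_assoc, hy, zero_mul]
  have hzero : ∀ c : R, TwoSidedIdeal.span {c} = ⊥ → c = 0 := fun c hc ↦ by
    rw [← TwoSidedIdeal.mem_bot, ← hc]
    exact TwoSidedIdeal.subset_span rfl
  refine (hprime (.span {a}) (.span {b}) (le_bot_iff.mp (TwoSidedIdeal.span_le.mpr ?_))).imp
    (hzero a) (hzero b)
  rintro _ ⟨x, hx, y, hy, rfl⟩
  exact key x hx y hy

/-- The image of a two-sided ideal in an overring, as a `ℤ`-submodule. -/
def imageSubmodule (f : R →+* Q) (A : TwoSidedIdeal R) : Submodule ℤ Q :=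
  Submodule.span ℤ (f '' A)

variable {f : R →+* Q}

theorem mem_imageSubmodule {A : TwoSidedIdeal R} {q : Q} :
    q ∈ imageSubmodule f A ↔ ∃ a ∈ A, f a = q := by
  refine ⟨fun h ↦ ?_, fun h ↦ Submodule.subset_span h⟩
  induction h using Submodule.span_induction with
  | mem x hx => exact hx
  | zero => exact ⟨0, A.zero_mem, map_zero f⟩
  | add x y _ _ hx hy =>
    obtain ⟨⟨a, ha, rfl⟩, b, hb, rfl⟩ := hx, hy
    exact ⟨a + b, A.add_mem ha hb, map_add f a b⟩
  | smul n x _ hx =>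
    obtain ⟨a, ha, rfl⟩ := hx
    exact ⟨n • a, zsmul_mem ha n, map_zsmul f n a⟩

theorem map_mem_imageSubmodule {A : TwoSidedIdeal R} {a : R} (ha : a ∈ A) :
    f a ∈ imageSubmodule f A :=
  mem_imageSubmodule.mpr ⟨a, ha, rfl⟩

theorem imageSubmodule_mono {A B : TwoSidedIdeal R} (h : A ≤ B) :
    imageSubmodule f A ≤ imageSubmodule f B :=
  Submodule.span_mono (Set.image_mono h)

theorem imageSubmodule_prodTI (A B : TwoSidedIdeal R) :
    imageSubmodule f (prodTI A B) = imageSubmodule f A * imageSubmodule f B := by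
  refine le_antisymm (fun q hq ↦ ?_) (Submodule.mul_le.mpr fun p hp q hq ↦ ?_)
  · obtain ⟨x, hx, rfl⟩ := mem_imageSubmodule.mp hq
    rw [mem_prodTI_iff] at hx
    clear hq
    induction hx using AddSubgroup.closure_induction with
    | mem x hx =>
      obtain ⟨a, ha, b, hb, rfl⟩ := hx
      rw [map_mul]
      exact Submodule.mul_mem_mul (map_mem_imageSubmodule ha) (map_mem_imageSubmodule hb)
    | zero => rw [map_zero]; exact zero_mem _
    | add x y _ _ hx hy => rw [map_add]; exact add_mem hx hy
    | neg x _ hx => rw [map_neg]; exact neg_mem hx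
  · obtain ⟨a, ha, rfl⟩ := mem_imageSubmodule.mp hp
    obtain ⟨b, hb, rfl⟩ := mem_imageSubmodule.mp hq
    rw [← map_mul]
    exact map_mem_imageSubmodule (TwoSidedIdeal.subset_span ⟨a, ha, b, hb, rfl⟩)

theorem imageSubmodule_sup (A B : TwoSidedIdeal R) :
    imageSubmodule f (A ⊔ B) = imageSubmodule f A ⊔ imageSubmodule f B := by
  refine le_antisymm (fun q hq ↦ ?_)
    (sup_le (imageSubmodule_mono le_sup_left) (imageSubmodule_mono le_sup_right))
  obtain ⟨x, hx, rfl⟩ := mem_imageSubmodule.mp hq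
  obtain ⟨a, ha, b, hb, rfl⟩ := TwoSidedIdeal.mem_sup.mp hx
  rw [map_add]
  exact Submodule.add_mem_sup (map_mem_imageSubmodule ha) (map_mem_imageSubmodule hb)

theorem isBimod_of_forall {X : Submodule ℤ Q} (h : ∀ r : R, ∀ x ∈ X, f r * x ∈ X ∧ x * f r ∈ X) :
    IsBimod (imageSubmodule f ⊤) X := by
  have h₁ : (1 : Q) ∈ imageSubmodule f ⊤ := mem_imageSubmodule.mpr ⟨1, by simp, map_one f⟩
  constructor
  · refine le_antisymm (Submodule.mul_le.mpr fun q hq x hx ↦ ?_) fun x hx ↦ ?_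
    · obtain ⟨r, -, rfl⟩ := mem_imageSubmodule.mp hq
      exact (h r x hx).1
    · simpa using Submodule.mul_mem_mul h₁ hx
  · refine le_antisymm (Submodule.mul_le.mpr fun x hx q hq ↦ ?_) fun x hx ↦ ?_
    · obtain ⟨r, -, rfl⟩ := mem_imageSubmodule.mp hq
      exact (h r x hx).2
    · simpa using Submodule.mul_mem_mul hx h₁

theorem isBimod_imageSubmodule (A : TwoSidedIdeal R) :
    IsBimod (imageSubmodule f ⊤) (imageSubmodule f A) := by
  refine isBimod_of_forall fun r x hx ↦ ?_
  obtain ⟨a, ha, rfl⟩ := mem_imageSubmodule.mp hx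
  rw [← map_mul, ← map_mul]
  exact ⟨map_mem_imageSubmodule (A.mul_mem_left _ _ ha),
    map_mem_imageSubmodule (A.mul_mem_right _ _ ha)⟩

/-- Under commutativity of ideal products and SDML, `(A + B)(A ∩ B) = AB`. -/
theorem imageSubmodule_sup_mul_inf
    (hcomm : ∀ I J : TwoSidedIdeal R, prodTI I J = prodTI J I)
    (hsdml : ∀ A B : TwoSidedIdeal R, ∀ r : R,
      ∃ x ∈ colonSetL (A : Set R) (B : Set R),
      ∃ y ∈ colonSetL (B : Set R) (A : Set R), r = x + y) (A B : TwoSidedIdeal R) :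
    imageSubmodule f (A ⊔ B) * imageSubmodule f (A ⊓ B) =
      imageSubmodule f A * imageSubmodule f B := by
  have hc : ∀ I J, imageSubmodule f I * imageSubmodule f J =
      imageSubmodule f J * imageSubmodule f I := fun I J ↦ by
    rw [← imageSubmodule_prodTI, hcomm, imageSubmodule_prodTI]
  apply le_antisymm
  · rw [imageSubmodule_sup, Submodule.sup_mul]
    refine sup_le (mul_le_mul' le_rfl (imageSubmodule_mono inf_le_right)) ?_
    rw [hc A B]
    exact mul_le_mul' le_rfl (imageSubmodule_mono inf_le_left)
  · rw [hc (A ⊔ B), imageSubmodule_sup, Submodule.mul_sup]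
    obtain ⟨x, hx, y, hy, hxy⟩ := hsdml A B 1
    have hone : ∀ q : Q, q = f x * q + f y * q := fun q ↦ by
      rw [← add_mul, ← map_add, ← hxy, map_one, one_mul]
    have hl : ∀ q ∈ imageSubmodule f A * imageSubmodule f B,
        f y * q ∈ imageSubmodule f (A ⊓ B) * imageSubmodule f B := fun q hq ↦ by
      induction hq using Submodule.mul_induction_on' with
      | mem_mul_mem m hm n hn =>
        obtain ⟨a, ha, rfl⟩ := mem_imageSubmodule.mp hm
        rw [← mul_assoc, ← map_mul]
        exact Submodule.mul_mem_mul
          (map_mem_imageSubmodule ⟨A.mul_mem_left _ _ ha, hy a ha⟩) hn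
      | add p _ q _ hp hq => rw [mul_add]; exact add_mem hp hq
    have hr : ∀ q ∈ imageSubmodule f B * imageSubmodule f A,
        f x * q ∈ imageSubmodule f (A ⊓ B) * imageSubmodule f A := fun q hq ↦ by
      induction hq using Submodule.mul_induction_on' with
      | mem_mul_mem m hm n hn =>
        obtain ⟨b, hb, rfl⟩ := mem_imageSubmodule.mp hm
        rw [← mul_assoc, ← map_mul]
        exact Submodule.mul_mem_mul
          (map_mem_imageSubmodule ⟨hx b hb, B.mul_mem_left _ _ hb⟩) hn
      | add p _ q _ hp hq => rw [mul_add]; exact add_mem hp hq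
    intro q hq
    rw [hone q]
    exact Submodule.add_mem_sup (hr q (hc A B ▸ hq)) (hl q hq)

/-- If `cR ⊆ Rc` with `f c` a unit, then `Rc` has the right inverse `c⁻¹R`. -/
theorem hasRightInv_imageSubmodule {I : TwoSidedIdeal R} {c : R} (hc : IsUnit (f c))
    (hI : (I : Set R) = {x | ∃ r, x = r * c}) :
    HasRightInv (imageSubmodule f ⊤) (imageSubmodule f I) := by
  obtain ⟨u, hu⟩ := hc
  have hmem : ∀ {x}, x ∈ I ↔ ∃ r, x = r * c := fun {x} ↦ Set.ext_iff.mp hI x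
  refine ⟨(imageSubmodule f ⊤).map (LinearMap.mulLeft ℤ (↑u⁻¹ : Q)), isBimod_of_forall ?_, ?_⟩
  · rintro r _ ⟨q, hq, rfl⟩
    obtain ⟨t, -, rfl⟩ := mem_imageSubmodule.mp hq
    obtain ⟨s, hs⟩ := hmem.mp (I.mul_mem_right c r (hmem.mpr ⟨1, (one_mul c).symm⟩))
    refine ⟨⟨f (s * t), map_mem_imageSubmodule trivial, ?_⟩,
      f (t * r), map_mem_imageSubmodule trivial, ?_⟩
    · have : (u : Q) * f r = f s * u := by rw [hu, ← map_mul, hs, map_mul]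
      simp only [LinearMap.mulLeft_apply, map_mul, ← mul_assoc]
      congr 1
      rw [Units.inv_mul_eq_iff_eq_mul, ← mul_assoc, this, Units.mul_inv_cancel_right]
    · simp [mul_assoc]
  · apply le_antisymm
    · rw [Submodule.mul_le]
      rintro p hp _ ⟨q, hq, rfl⟩
      obtain ⟨t, -, rfl⟩ := mem_imageSubmodule.mp hq
      obtain ⟨a, ha, rfl⟩ := mem_imageSubmodule.mp hp
      obtain ⟨s, rfl⟩ := hmem.mp ha
      refine mem_imageSubmodule.mpr ⟨s * t, trivial, ?_⟩
      simp [← hu, mul_assoc]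
    · intro q hq
      have := Submodule.mul_mem_mul (map_mem_imageSubmodule (f := f) (hmem.mpr ⟨1, (one_mul c).symm⟩))
        (Submodule.mem_map_of_mem (f := LinearMap.mulLeft ℤ (↑u⁻¹ : Q)) hq)
      simpa [← hu] using this

/-- If `Rd ⊆ dR` with `f d` a unit, then `dR` has the left inverse `Rd⁻¹`. -/
theorem hasLeftInv_imageSubmodule {I : TwoSidedIdeal R} {d : R} (hd : IsUnit (f d))
    (hI : (I : Set R) = {x | ∃ r, x = d * r}) :
    HasLeftInv (imageSubmodule f ⊤) (imageSubmodule f I) := by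
  obtain ⟨u, hu⟩ := hd
  have hmem : ∀ {x}, x ∈ I ↔ ∃ r, x = d * r := fun {x} ↦ Set.ext_iff.mp hI x
  refine ⟨(imageSubmodule f ⊤).map (LinearMap.mulRight ℤ (↑u⁻¹ : Q)), isBimod_of_forall ?_, ?_⟩
  · rintro r _ ⟨q, hq, rfl⟩
    obtain ⟨t, -, rfl⟩ := mem_imageSubmodule.mp hq
    obtain ⟨s, hs⟩ := hmem.mp (I.mul_mem_left r d (hmem.mpr ⟨1, (mul_one d).symm⟩))
    refine ⟨⟨f (r * t), map_mem_imageSubmodule trivial, ?_⟩,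
      f (t * s), map_mem_imageSubmodule trivial, ?_⟩
    · simp [mul_assoc]
    · have : f r * (u : Q) = u * f s := by rw [hu, ← map_mul, hs, map_mul]
      simp only [LinearMap.mulRight_apply, map_mul, mul_assoc]
      congr 1
      rw [Units.eq_inv_mul_iff_mul_eq, ← mul_assoc, ← this, Units.mul_inv_cancel_right]
  · apply le_antisymm
    · rw [Submodule.mul_le]
      rintro _ ⟨q, hq, rfl⟩ p hp
      obtain ⟨t, -, rfl⟩ := mem_imageSubmodule.mp hq
      obtain ⟨a, ha, rfl⟩ := mem_imageSubmodule.mp hp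
      obtain ⟨s, rfl⟩ := hmem.mp ha
      refine mem_imageSubmodule.mpr ⟨t * s, trivial, ?_⟩
      simp [← hu, mul_assoc]
    · intro q hq
      have := Submodule.mul_mem_mul
        (Submodule.mem_map_of_mem (f := LinearMap.mulRight ℤ (↑u⁻¹ : Q)) hq)
        (map_mem_imageSubmodule (f := f) (hmem.mpr ⟨1, (mul_one d).symm⟩))
      simpa [← hu] using this

theorem toAddSubgroup_mul (X Y : Submodule ℤ Q) :
    (X * Y).toAddSubgroup = mulGrp X.toAddSubgroup Y.toAddSubgroup := by
  apply le_antisymm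
  · exact fun q hq ↦ Submodule.mul_induction_on (M := X) (N := Y) hq
      (fun x hx y hy ↦ AddSubgroup.subset_closure ⟨x, hx, y, hy, rfl⟩) fun _ _ ↦ add_mem
  · refine (AddSubgroup.closure_le _).mpr ?_
    rintro _ ⟨x, hx, y, hy, rfl⟩
    exact Submodule.mul_mem_mul (Submodule.mem_toAddSubgroup _ |>.mp hx) hy

theorem isInvertibleIdeal_of_hasLeftInv_of_hasRightInv {A : TwoSidedIdeal R}
    (hl : HasLeftInv (imageSubmodule f ⊤) (imageSubmodule f A))
    (hr : HasRightInv (imageSubmodule f ⊤) (imageSubmodule f A)) : IsInvertibleIdeal f A := by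
  obtain ⟨X, hX, hXA, hAX⟩ := exists_two_sided_inv hl hr
  have hA : AddSubgroup.closure (f '' A) = (imageSubmodule f A).toAddSubgroup :=
    (Submodule.span_int_eq_addSubgroupClosure _).symm
  have htop : AddSubgroup.closure (Set.range f) = (imageSubmodule f ⊤).toAddSubgroup := by
    rw [imageSubmodule, Submodule.span_int_eq_addSubgroupClosure, TwoSidedIdeal.coe_top,
      Set.image_univ]
  refine ⟨X.toAddSubgroup, fun r x hx ↦ ⟨?_, ?_⟩, ?_, ?_⟩
  · have := Submodule.mul_mem_mul
      (map_mem_imageSubmodule (f := f) (A := ⊤) (a := r) trivial) hx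
    rwa [hX.left] at this
  · have := Submodule.mul_mem_mul hx
      (map_mem_imageSubmodule (f := f) (A := ⊤) (a := r) trivial)
    rwa [hX.right] at this
  · rw [hA, htop, ← toAddSubgroup_mul, hXA]
  · rw [hA, htop, ← toAddSubgroup_mul, hAX]

/-- A two-sided ideal that is a finite sum of additive subgroups, each of which is a two-sided
ideal, is the supremum of these ideals. -/
theorem eq_finset_sup_of_coe_eq_iSup {n : ℕ} {A : TwoSidedIdeal R} {D : Fin n → TwoSidedIdeal R}
    (h : (A : Set R) = ↑(⨆ i, AddSubgroup.closure (D i : Set R))) :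
    A = Finset.univ.sup D := by
  apply le_antisymm
  · intro x hx
    have hx : x ∈ (A : Set R) := hx
    rw [h, SetLike.mem_coe] at hx
    refine AddSubgroup.iSup_induction _ (C := (· ∈ Finset.univ.sup D)) hx (fun i x hx ↦ ?_)
      (zero_mem _) fun _ _ ↦ add_mem
    induction hx using AddSubgroup.closure_induction with
    | mem x hx => exact Finset.le_sup (f := D) (Finset.mem_univ i) hx
    | zero => exact zero_mem _
    | add x y _ _ hx hy => exact add_mem hx hy
    | neg x _ hx => exact neg_mem hx
  · refine Finset.sup_le fun i _ x hx ↦ ?_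
    change x ∈ (A : Set R)
    rw [h]
    exact le_iSup (fun i ↦ AddSubgroup.closure (D i : Set R)) i (AddSubgroup.subset_closure hx)

/-- A property of nonzero ideals stable under binary sums passes to a nonzero finite sum. -/
theorem finset_sup_induction_ne_bot {ι : Type*} {p : TwoSidedIdeal R → Prop}
    (hsup : ∀ A B, p A → p B → p (A ⊔ B)) {s : Finset ι} {D : ι → TwoSidedIdeal R}
    (hD : ∀ i ∈ s, D i ≠ ⊥ → p (D i)) (hs : s.sup D ≠ ⊥) : p (s.sup D) := by
  suffices s.sup D = ⊥ ∨ p (s.sup D) from this.resolve_left hs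
  refine Finset.sup_induction (p := fun I ↦ I = ⊥ ∨ p I) (.inl rfl) ?_ fun i hi ↦ ?_
  · rintro A (rfl | hA) B (rfl | hB)
    · simp
    · simp [hB]
    · simp [hA]
    · exact .inr (hsup A B hA hB)
  · exact or_iff_not_imp_left.mpr (hD i hi)

end TwoSidedIdeal

/-- Let `R` be a prime Noetherian ring whose regular elements satisfy the Ore
conditions, with classical quotient ring `Q ⊇ R`.  Suppose every two-sided
ideal `A` can be written `Rc₁ + ⋯ + Rc_m = A = d₁R + ⋯ + d_nR` with each
`Rc_j`, `d_iR` two-sided.  If the product of two-sided ideals is commutative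
and `R` satisfies SDML (`(A :ℓ B) + (B :ℓ A) = R`), then every nonzero
two-sided ideal of `R` is invertible, i.e. `R` is an Asano prime ring. -/
theorem stmt_16 {R Q : Type*} [Ring R] [Ring Q]
    [IsNoetherianRing R] [IsNoetherianRing Rᵐᵒᵖ]
    -- `R` is prime
    (hprime : ∀ I J : TwoSidedIdeal R, prodTI I J = ⊥ → I = ⊥ ∨ J = ⊥)
    -- the regular elements of `R` satisfy the left and right Ore conditions
    (horel : ∀ a s : R, IsRegular s → ∃ t b : R, IsRegular t ∧ t * a = b * s)
    (horer : ∀ a s : R, IsRegular s → ∃ t b : R, IsRegular t ∧ a * t = s * b)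
    -- `Q` is the classical quotient ring of `R`, and `R ⊆ Q` via `f`
    (f : R →+* Q)
    (hinj : Function.Injective f)
    (hunit : ∀ s : R, IsRegular s → IsUnit (f s))
    (hlfrac : ∀ q : Q, ∃ s a : R, IsRegular s ∧ f s * q = f a)
    (hrfrac : ∀ q : Q, ∃ s a : R, IsRegular s ∧ q * f s = f a)
    -- each ideal `A` satisfies `Rc₁ + ⋯ + Rc_m = A = d₁R + ⋯ + d_nR`
    -- with every `Rc_j` and `d_iR` a two-sided ideal
    (hdecomp : ∀ A : TwoSidedIdeal R, ∃ (m n : ℕ) (c : Fin m → R) (d : Fin n → R),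
      (∀ j : Fin m, ∀ x ∈ {x : R | ∃ r : R, x = r * c j}, ∀ t : R,
        x * t ∈ {x : R | ∃ r : R, x = r * c j}) ∧
      (∀ i : Fin n, ∀ x ∈ {x : R | ∃ r : R, x = d i * r}, ∀ t : R,
        t * x ∈ {x : R | ∃ r : R, x = d i * r}) ∧
      (A : Set R) = ↑(⨆ j : Fin m, AddSubgroup.closure {x : R | ∃ r : R, x = r * c j}) ∧
      (A : Set R) = ↑(⨆ i : Fin n, AddSubgroup.closure {x : R | ∃ r : R, x = d i * r}))
    -- the product of two-sided ideals is commutative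
    (hcomm : ∀ I J : TwoSidedIdeal R, prodTI I J = prodTI J I)
    -- SDML: `(A :ℓ B) + (B :ℓ A) = R`
    (hsdml : ∀ A B : TwoSidedIdeal R, ∀ r : R,
      ∃ x ∈ colonSetL (A : Set R) (B : Set R),
      ∃ y ∈ colonSetL (B : Set R) (A : Set R), r = x + y) :
    ∀ A : TwoSidedIdeal R, A ≠ ⊥ → IsInvertibleIdeal f A := by
  have hcancel := eq_zero_or_eq_zero_of_prime hprime
  have hsup := imageSubmodule_sup_mul_inf (f := f) hcomm hsdml
  have hc : ∀ I J, imageSubmodule f I * imageSubmodule f J =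
      imageSubmodule f J * imageSubmodule f I := fun I J ↦ by
    rw [← imageSubmodule_prodTI, hcomm, imageSubmodule_prodTI]
  intro A hA
  obtain ⟨m, n, c, d, hcR, hRd, hAc, hAd⟩ := hdecomp A
  let C : Fin m → TwoSidedIdeal R := fun j ↦ .mk' {x | ∃ r, x = r * c j} ⟨0, by simp⟩
    (by rintro _ _ ⟨r, rfl⟩ ⟨s, rfl⟩; exact ⟨r + s, by rw [add_mul]⟩)
    (by rintro _ ⟨r, rfl⟩; exact ⟨-r, by rw [neg_mul]⟩)
    (by rintro t _ ⟨r, rfl⟩; exact ⟨t * r, by rw [mul_assoc]⟩)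
    (fun {x t} hx ↦ hcR j x hx t)
  let D : Fin n → TwoSidedIdeal R := fun i ↦ .mk' {x | ∃ r, x = d i * r} ⟨0, by simp⟩
    (by rintro _ _ ⟨r, rfl⟩ ⟨s, rfl⟩; exact ⟨r + s, by rw [mul_add]⟩)
    (by rintro _ ⟨r, rfl⟩; exact ⟨-r, by rw [mul_neg]⟩)
    (fun {t x} hx ↦ hRd i x hx t)
    (by rintro _ t ⟨r, rfl⟩; exact ⟨r * t, by rw [mul_assoc]⟩)
  have hC : ∀ j, (C j : Set R) = {x | ∃ r, x = r * c j} := fun j ↦ TwoSidedIdeal.coe_mk' ..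
  have hD : ∀ i, (D i : Set R) = {x | ∃ r, x = d i * r} := fun i ↦ TwoSidedIdeal.coe_mk' ..
  have hAC : A = Finset.univ.sup C := eq_finset_sup_of_coe_eq_iSup (by simpa only [hC] using hAc)
  have hAD : A = Finset.univ.sup D := eq_finset_sup_of_coe_eq_iSup (by simpa only [hD] using hAd)
  apply isInvertibleIdeal_of_hasLeftInv_of_hasRightInv
  · rw [hAD] at hA ⊢
    refine finset_sup_induction_ne_bot
      (p := fun I ↦ HasLeftInv (imageSubmodule f ⊤) (imageSubmodule f I))
      (fun I J hI hJ ↦ .of_mul (isBimod_imageSubmodule (I ⊓ J)) ?_) (fun i _ hi ↦ ?_) hA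
    · rw [hc, hsup]
      exact hI.mul hJ
    · refine hasLeftInv_imageSubmodule (hunit (d i) ?_) (hD i)
      refine isRegular_of_mul_right_closed hcancel (fun h ↦ hi ?_) fun t ↦
        hRd i (d i) ⟨1, (mul_one _).symm⟩ t
      exact SetLike.coe_injective (by rw [hD, h]; ext; simp)
  · rw [hAC] at hA ⊢
    refine finset_sup_induction_ne_bot
      (p := fun I ↦ HasRightInv (imageSubmodule f ⊤) (imageSubmodule f I))
      (fun I J hI hJ ↦ .of_mul (isBimod_imageSubmodule (I ⊓ J)) ?_) (fun i _ hi ↦ ?_) hA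
    · rw [hsup]
      exact hI.mul hJ
    · refine hasRightInv_imageSubmodule (hunit (c i) ?_) (hC i)
      refine isRegular_of_mul_left_closed hcancel (fun h ↦ hi ?_) fun t ↦
        hcR i (c i) ⟨1, (one_mul _).symm⟩ t
      exact SetLike.coe_injective (by rw [hC, h]; ext; simp)
end

section
/- Let R be a prime (left and right) Noetherian ring whose set of regular elements satisfies the Ore conditions, so that the classical quotient ring Q = Q_cl(R) exists and R ⊆ Q. If R is an Asano prime ring (every nonzero two-sided ideal of R is invertible), then the lattice of two-sided ideals of R is distributive: A + (B ∩ C) = (A + B) ∩ (A + C) for all two-sided ideals A, B, C of R. -/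
/-- If `m` and `a + m` have inverses relative to `r`, where `m ≤ b` and `m ≤ c`, then the lattice
identity `(a + b) ⊓ (a + c) ≤ a + (b ⊓ c)` holds in the semiring of additive subgroups. -/
lemma sup_inf_sup_le_of_invertible {Q : Type*} [Ring Q] {r a b c m x y : Submodule ℤ Q}
    (hra : r * a = a) (hrb : b * r = b) (hrc : c * r = c) (hrs : r * (a ⊔ m) = a ⊔ m)
    (hmb : m ≤ b) (hmc : m ≤ c) (hm : b ⊓ c ≤ m) (hmx : m * x = r) (hxm : x * m = r)
    (hsy : (a ⊔ m) * y = r) (hys : y * (a ⊔ m) = r)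
    (hpr : ((a ⊔ b) ⊓ (a ⊔ c)) ≤ ((a ⊔ b) ⊓ (a ⊔ c)) * r) :
    (a ⊔ b) ⊓ (a ⊔ c) ≤ a ⊔ m := by
  have key : ∀ d : Submodule ℤ Q, d * r = d → m ≤ d → (a ⊔ d) * y * m ≤ d := by
    intro d hd hmd
    have hle : a ⊔ d ≤ d * x * (a ⊔ m) := by
      rw [Submodule.mul_sup, mul_assoc d x m, hxm, hd]
      refine sup_le_sup_right ?_ d
      calc a = m * x * a := by rw [hmx, hra]
        _ ≤ d * x * a := by gcongr
    calc (a ⊔ d) * y * m ≤ d * x * (a ⊔ m) * y * m :=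
          by gcongr
      _ = d * x * ((a ⊔ m) * y * m) := by simp only [mul_assoc]
      _ = d * x * (m * x * m) := by rw [hsy, hmx]
      _ = d * (x * m) * (x * m) := by simp only [mul_assoc]
      _ = d := by rw [hxm, hd, hd]
  set p := (a ⊔ b) ⊓ (a ⊔ c) with hp
  have hpym : p * y * m ≤ m := by
    refine le_trans (le_inf ?_ ?_) hm
    · exact (mul_le_mul_left (mul_le_mul_left inf_le_left y) m).trans
        (key b hrb hmb)
    · exact (mul_le_mul_left (mul_le_mul_left inf_le_right y) m).trans
        (key c hrc hmc)
  calc p ≤ p * r := hpr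
    _ = p * y * (r * (a ⊔ m)) := by rw [hrs, mul_assoc, hys]
    _ = p * y * m * x * (a ⊔ m) := by rw [← hmx]; simp only [mul_assoc]
    _ ≤ m * x * (a ⊔ m) := by gcongr
    _ = a ⊔ m := by rw [hmx, hrs]

/-- The image of a two-sided ideal of `R` in `Q`, as a `ℤ`-submodule. -/
def idealImage {R Q : Type*} [Ring R] [Ring Q] (f : R →+* Q) (I : TwoSidedIdeal R) :
    Submodule ℤ Q :=
  Submodule.span ℤ (f '' I)

section idealImage

variable {R Q : Type*} [Ring R] [Ring Q] {f : R →+* Q}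

lemma mem_idealImage {I : TwoSidedIdeal R} {q : Q} :
    q ∈ idealImage f I ↔ ∃ a ∈ I, f a = q := by
  constructor
  · intro h
    induction h using Submodule.span_induction with
    | mem x hx => exact hx
    | zero => exact ⟨0, I.zero_mem, map_zero f⟩
    | add x y _ _ hx hy =>
      obtain ⟨a, ha, rfl⟩ := hx
      obtain ⟨b, hb, rfl⟩ := hy
      exact ⟨a + b, I.add_mem ha hb, map_add f a b⟩
    | smul n x _ hx =>
      obtain ⟨a, ha, rfl⟩ := hx
      exact ⟨n • a, zsmul_mem ha n, map_zsmul f n a⟩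
  · rintro ⟨a, ha, rfl⟩
    exact Submodule.subset_span ⟨a, ha, rfl⟩

lemma map_mem_idealImage (hf : Function.Injective f) {I : TwoSidedIdeal R} {a : R} :
    f a ∈ idealImage f I ↔ a ∈ I := by
  rw [mem_idealImage]
  exact ⟨fun ⟨b, hb, hab⟩ => hf hab ▸ hb, fun h => ⟨a, h, rfl⟩⟩

lemma idealImage_mono {I J : TwoSidedIdeal R} (h : I ≤ J) : idealImage f I ≤ idealImage f J :=
  Submodule.span_mono (Set.image_mono h)

lemma idealImage_sup (I J : TwoSidedIdeal R) :
    idealImage f (I ⊔ J) = idealImage f I ⊔ idealImage f J := by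
  refine le_antisymm ?_ (sup_le (idealImage_mono le_sup_left) (idealImage_mono le_sup_right))
  intro q hq
  obtain ⟨s, hs, rfl⟩ := mem_idealImage.1 hq
  obtain ⟨a, ha, b, hb, rfl⟩ := TwoSidedIdeal.mem_sup.1 hs
  rw [map_add]
  exact Submodule.add_mem_sup (mem_idealImage.2 ⟨a, ha, rfl⟩) (mem_idealImage.2 ⟨b, hb, rfl⟩)

lemma idealImage_inf (hf : Function.Injective f) (I J : TwoSidedIdeal R) :
    idealImage f (I ⊓ J) = idealImage f I ⊓ idealImage f J := by
  refine le_antisymm (le_inf (idealImage_mono inf_le_left) (idealImage_mono inf_le_right)) ?_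
  rintro q ⟨hI, hJ⟩
  obtain ⟨a, ha, rfl⟩ := mem_idealImage.1 hI
  exact mem_idealImage.2 ⟨a, ⟨ha, (map_mem_idealImage hf).1 hJ⟩, rfl⟩

lemma idealImage_top_mul (I : TwoSidedIdeal R) :
    idealImage f ⊤ * idealImage f I = idealImage f I := by
  refine le_antisymm (Submodule.mul_le.2 fun x hx y hy => ?_) fun q hq => ?_
  · obtain ⟨a, -, rfl⟩ := mem_idealImage.1 hx
    obtain ⟨b, hb, rfl⟩ := mem_idealImage.1 hy
    exact mem_idealImage.2 ⟨a * b, I.mul_mem_left a b hb, map_mul f a b⟩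
  · rw [← one_mul q]
    exact Submodule.mul_mem_mul (mem_idealImage.2 ⟨1, trivial, map_one f⟩) hq

lemma idealImage_mul_top (I : TwoSidedIdeal R) :
    idealImage f I * idealImage f ⊤ = idealImage f I := by
  refine le_antisymm (Submodule.mul_le.2 fun x hx y hy => ?_) fun q hq => ?_
  · obtain ⟨a, ha, rfl⟩ := mem_idealImage.1 hx
    obtain ⟨b, -, rfl⟩ := mem_idealImage.1 hy
    exact mem_idealImage.2 ⟨a * b, I.mul_mem_right a b ha, map_mul f a b⟩
  · rw [← mul_one q]
    exact Submodule.mul_mem_mul hq (mem_idealImage.2 ⟨1, trivial, map_one f⟩)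

lemma toIntSubmodule_mulGrp (X Y : AddSubgroup Q) :
    (mulGrp X Y).toIntSubmodule = X.toIntSubmodule * Y.toIntSubmodule := by
  rw [mulGrp, AddSubgroup.toIntSubmodule_closure, Submodule.mul_eq_span_mul_set]
  congr 1
  ext q
  simp [Set.mem_mul, eq_comm]

lemma IsInvertibleIdeal.exists_mul_eq {I : TwoSidedIdeal R} (h : IsInvertibleIdeal f I) :
    ∃ x : Submodule ℤ Q, x * idealImage f I = idealImage f ⊤ ∧
      idealImage f I * x = idealImage f ⊤ := by
  obtain ⟨X, -, h₁, h₂⟩ := h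
  have h_top : (AddSubgroup.closure (Set.range f)).toIntSubmodule = idealImage f ⊤ := by
    rw [AddSubgroup.toIntSubmodule_closure, idealImage, TwoSidedIdeal.coe_top, Set.image_univ]
  refine ⟨X.toIntSubmodule, ?_, ?_⟩
  · rw [← h_top, ← h₁, toIntSubmodule_mulGrp, AddSubgroup.toIntSubmodule_closure, idealImage]
  · rw [← h_top, ← h₂, toIntSubmodule_mulGrp, AddSubgroup.toIntSubmodule_closure, idealImage]

end idealImage

lemma prodTI_le_inf {R : Type*} [Ring R] (I J : TwoSidedIdeal R) : prodTI I J ≤ I ⊓ J := by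
  refine TwoSidedIdeal.span_le.2 ?_
  rintro _ ⟨a, ha, b, hb, rfl⟩
  exact ⟨I.mul_mem_right a b ha, J.mul_mem_left a b hb⟩

/-- Let `R` be a prime Noetherian ring with classical quotient ring `Q ⊇ R`.
If `R` is an Asano prime ring (every nonzero two-sided ideal is invertible),
then the lattice of two-sided ideals of `R` is distributive:
`A + (B ∩ C) = (A + B) ∩ (A + C)`. -/
theorem stmt_18 {R Q : Type*} [Ring R] [Ring Q]
    [IsNoetherianRing R] [IsNoetherianRing Rᵐᵒᵖ]
    -- `R` is prime
    (hprime : ∀ I J : TwoSidedIdeal R, prodTI I J = ⊥ → I = ⊥ ∨ J = ⊥)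
    -- the regular elements of `R` satisfy the left and right Ore conditions
    (horel : ∀ a s : R, IsRegular s → ∃ t b : R, IsRegular t ∧ t * a = b * s)
    (horer : ∀ a s : R, IsRegular s → ∃ t b : R, IsRegular t ∧ a * t = s * b)
    -- `Q` is the classical quotient ring of `R`, and `R ⊆ Q` via `f`
    (f : R →+* Q)
    (hinj : Function.Injective f)
    (hunit : ∀ s : R, IsRegular s → IsUnit (f s))
    (hlfrac : ∀ q : Q, ∃ s a : R, IsRegular s ∧ f s * q = f a)
    (hrfrac : ∀ q : Q, ∃ s a : R, IsRegular s ∧ q * f s = f a)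
    -- `R` is an Asano prime ring
    (hasano : ∀ A : TwoSidedIdeal R, A ≠ ⊥ → IsInvertibleIdeal f A)
    (A B C : TwoSidedIdeal R) :
    A ⊔ (B ⊓ C) = (A ⊔ B) ⊓ (A ⊔ C) := by
  by_cases hB : B = ⊥
  · simp [hB]
  by_cases hC : C = ⊥
  · simp [hC]
  have hM : B ⊓ C ≠ ⊥ := fun h =>
    (hprime B C (le_bot_iff.1 (h ▸ prodTI_le_inf B C))).elim hB hC
  have hS : A ⊔ B ⊓ C ≠ ⊥ := fun h => hM (le_bot_iff.1 (h ▸ le_sup_right))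
  obtain ⟨x, hxm, hmx⟩ := (hasano _ hM).exists_mul_eq
  obtain ⟨y, hys, hsy⟩ := (hasano _ hS).exists_mul_eq
  refine le_antisymm sup_inf_le fun p hp => ?_
  have hle : idealImage f ((A ⊔ B) ⊓ (A ⊔ C)) ≤ idealImage f (A ⊔ B ⊓ C) := by
    have hpr := (idealImage_mul_top (f := f) ((A ⊔ B) ⊓ (A ⊔ C))).ge
    have hrs := idealImage_top_mul (f := f) (A ⊔ B ⊓ C)
    rw [idealImage_inf hinj, idealImage_sup, idealImage_sup] at hpr ⊢
    rw [idealImage_sup] at hrs hys hsy ⊢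
    exact sup_inf_sup_le_of_invertible (idealImage_top_mul A) (idealImage_mul_top B)
      (idealImage_mul_top C) hrs (idealImage_mono inf_le_left) (idealImage_mono inf_le_right)
      (idealImage_inf hinj B C).ge hmx hxm hsy hys hpr
  exact (map_mem_idealImage hinj).1 (hle ((map_mem_idealImage hinj).2 hp))
end

section
/- Let R be a commutative Noetherian integral domain. The following conditions are equivalent: (1) R is a Dedekind domain; (2) (A : B) + (B : A) = R for all ideals A, B of R; (3) (A + B : C) = (A : C) + (B : C) for all ideals A, B, C of R; (4) (A : B ∩ C) = (A : B) + (A : C) for all ideals A, B, C of R; (5) for every prime ideal P of R, the lattice of ideals of the localization R_P is totally ordered. -/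
namespace Ideal

variable {R : Type*} [CommRing R]

theorem colon_sup_colon_eq_top [IsDedekindDomain R] (A B : Ideal R) :
    A.colon B ⊔ B.colon A = ⊤ := by
  by_cases hD : A ⊔ B = ⊥
  · obtain ⟨rfl, rfl⟩ := sup_eq_bot_iff.mp hD
    simp
  obtain ⟨A', hA⟩ := dvd_iff_le.mpr (le_sup_left : A ≤ A ⊔ B)
  obtain ⟨B', hB⟩ := dvd_iff_le.mpr (le_sup_right : B ≤ A ⊔ B)
  have hAB : A' ⊔ B' = ⊤ := by
    apply mul_left_cancel₀ hD
    rw [mul_sup, ← hA, ← hB, mul_top]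
  have h₁ : A' ≤ A.colon B := fun r hr ↦ Submodule.mem_colon.mpr fun b hb ↦ by
    rw [hA, mul_comm]
    exact mul_mem_mul hr ((le_sup_right : B ≤ A ⊔ B) hb)
  have h₂ : B' ≤ B.colon A := fun r hr ↦ Submodule.mem_colon.mpr fun a ha ↦ by
    rw [hB, mul_comm]
    exact mul_mem_mul hr ((le_sup_left : A ≤ A ⊔ B) ha)
  exact top_le_iff.mp (hAB ▸ sup_le_sup h₁ h₂)

theorem sup_colon_of_colon_sup_colon_eq_top {A B : Ideal R}
    (h : A.colon B ⊔ B.colon A = ⊤) (C : Ideal R) :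
    (A ⊔ B).colon C = A.colon C ⊔ B.colon C := by
  refine le_antisymm (fun r hr ↦ ?_)
    (sup_le (Submodule.colon_mono le_sup_left subset_rfl)
      (Submodule.colon_mono le_sup_right subset_rfl))
  obtain ⟨u, hu, v, hv, huv⟩ := Submodule.mem_sup.mp ((eq_top_iff_one _).mp h)
  rw [Submodule.mem_colon] at hu hv hr
  have hr' : r = u * r + v * r := by rw [← add_mul, huv, one_mul]
  rw [hr']
  refine add_mem (Submodule.mem_sup_left ?_) (Submodule.mem_sup_right ?_) <;>
    refine Submodule.mem_colon.mpr fun c hc ↦ ?_ <;>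
    obtain ⟨a, ha, b, hb, hab⟩ := Submodule.mem_sup.mp (hr c hc)
  · rw [mul_smul, ← hab, smul_add]
    exact add_mem (A.smul_mem u ha) (hu b hb)
  · rw [mul_smul, ← hab, smul_add]
    exact add_mem (hv a ha) (B.smul_mem v hb)

theorem colon_inf_of_colon_sup_colon_eq_top {B C : Ideal R}
    (h : B.colon C ⊔ C.colon B = ⊤) (A : Ideal R) :
    A.colon (B ⊓ C) = A.colon B ⊔ A.colon C := by
  refine le_antisymm (fun r hr ↦ ?_)
    (sup_le (Submodule.colon_mono le_rfl fun _ hx ↦ hx.1)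
      (Submodule.colon_mono le_rfl fun _ hx ↦ hx.2))
  obtain ⟨u, hu, v, hv, huv⟩ := Submodule.mem_sup.mp ((eq_top_iff_one _).mp h)
  rw [Submodule.mem_colon] at hu hv hr
  have hr' : r = r * v + r * u := by rw [← mul_add, add_comm v, huv, mul_one]
  rw [hr']
  refine add_mem (Submodule.mem_sup_left ?_) (Submodule.mem_sup_right ?_) <;>
    refine Submodule.mem_colon.mpr fun x hx ↦ ?_ <;> rw [mul_smul]
  · exact hr _ ⟨B.smul_mem v hx, hv x hx⟩
  · exact hr _ ⟨hu x hx, C.smul_mem u hx⟩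

theorem le_of_not_colon_comap_le {P : Ideal R} [P.IsPrime]
    {I J : Ideal (Localization.AtPrime P)}
    (h : ¬ (I.comap (algebraMap R _)).colon (J.comap (algebraMap R _)) ≤ P) : J ≤ I := by
  obtain ⟨u, hu, huP⟩ := SetLike.not_le_iff_exists.mp h
  rw [← IsLocalization.map_under P.primeCompl _ J, map_le_iff_le_comap]
  intro y hy
  have hmem : algebraMap R (Localization.AtPrime P) u * algebraMap R _ y ∈ I := by
    rw [← map_mul]
    exact Submodule.mem_colon.mp hu y hy
  exact (unit_mul_mem_iff_mem I
    (IsLocalization.map_units (Localization.AtPrime P) (⟨u, huP⟩ : P.primeCompl))).mp hmem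

theorem le_total_of_colon_sup_colon_eq_top
    (h : ∀ A B : Ideal R, A.colon B ⊔ B.colon A = ⊤) (P : Ideal R) [hP : P.IsPrime]
    (I J : Ideal (Localization.AtPrime P)) : I ≤ J ∨ J ≤ I := by
  by_contra! hIJ
  refine hP.ne_top (top_le_iff.mp ?_)
  rw [← h (I.comap (algebraMap R _)) (J.comap (algebraMap R _))]
  exact sup_le (not_not.mp fun hn ↦ hIJ.2 (le_of_not_colon_comap_le hn))
    (not_not.mp fun hn ↦ hIJ.1 (le_of_not_colon_comap_le hn))

end Ideal

theorem IsDedekindDomain.of_localization_ideal_le_total {R : Type*} [CommRing R] [IsDomain R]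
    [IsNoetherianRing R]
    (h : ∀ (P : Ideal R) [P.IsPrime],
      ∀ I J : Ideal (Localization.AtPrime P), I ≤ J ∨ J ≤ I) : IsDedekindDomain R := by
  have : IsDedekindDomainDvr R :=
    { is_dvr_at_nonzero_prime := fun P hP _ ↦ by
        have : IsNoetherianRing (Localization.AtPrime P) :=
          IsLocalization.isNoetherianRing P.primeCompl _ inferInstance
        have : ValuationRing (Localization.AtPrime P) :=
          ValuationRing.iff_ideal_total.mpr ⟨h P⟩
        exact ((IsDiscreteValuationRing.TFAE _
          (IsLocalization.AtPrime.not_isField R hP _)).out 0 1).mpr this }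
  infer_instance


/-- For a commutative Noetherian domain `R`, the following are equivalent:
(1) `R` is a Dedekind domain;
(2) `(A : B) + (B : A) = R` for all ideals `A, B`;
(3) `(A + B : C) = (A : C) + (B : C)` for all ideals `A, B, C`;
(4) `(A : B ∩ C) = (A : B) + (A : C)` for all ideals `A, B, C`;
(5) the lattice of ideals of `R_P` is totally ordered for every prime `P`. -/
theorem stmt_19 {R : Type*} [CommRing R] [IsDomain R] [IsNoetherianRing R] :
    List.TFAE [
      IsDedekindDomain R,
      ∀ A B : Ideal R, A.colon B ⊔ B.colon A = ⊤,
      ∀ A B C : Ideal R, (A ⊔ B).colon C = A.colon C ⊔ B.colon C,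
      ∀ A B C : Ideal R, A.colon (B ⊓ C) = A.colon B ⊔ A.colon C,
      ∀ (P : Ideal R) [P.IsPrime],
        ∀ I J : Ideal (Localization.AtPrime P), I ≤ J ∨ J ≤ I] := by
  tfae_have 1 → 2 := fun _ ↦ Ideal.colon_sup_colon_eq_top
  tfae_have 2 → 3 := fun h A B ↦ Ideal.sup_colon_of_colon_sup_colon_eq_top (h A B)
  tfae_have 3 → 2 := fun h A B ↦ by
    have hAB := h A B (A ⊔ B)
    rw [(Submodule.colon_eq_top_iff_subset _).mpr subset_rfl] at hAB
    exact top_le_iff.mp (hAB.le.trans (sup_le_sup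
      (Submodule.colon_mono le_rfl (le_sup_right : B ≤ A ⊔ B))
      (Submodule.colon_mono le_rfl (le_sup_left : A ≤ A ⊔ B))))
  tfae_have 2 → 4 := fun h A B C ↦ Ideal.colon_inf_of_colon_sup_colon_eq_top (h B C) A
  tfae_have 4 → 2 := fun h A B ↦ by
    have hAB := h (B ⊓ A) B A
    rw [(Submodule.colon_eq_top_iff_subset ((B : Set R) ⊓ A)).mpr fun _ hx ↦ hx] at hAB
    exact top_le_iff.mp (hAB.le.trans (sup_le_sup
      (Submodule.colon_mono inf_le_right subset_rfl)
      (Submodule.colon_mono inf_le_left subset_rfl)))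
  tfae_have 2 → 5 := Ideal.le_total_of_colon_sup_colon_eq_top
  tfae_have 5 → 1 := IsDedekindDomain.of_localization_ideal_le_total
  tfae_finish
end
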